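/- arXiv:0905.3253 — 2 statements merged into one kernel-verified Lean document; each statement's English description precedes it below -/
import Mathlib

section
/- For every n ≥ 1, ∫_{ℝ^n} exp(−2∑_{j=1}^{n} E_j²) · (∏_{1≤a<b≤n} (E_a − E_b))⁴ dE = 2^{−n(2n−1/2)} · π^{n/2} · ∏_{j=1}^{n} Γ(2j + 1). -/
open Finset MeasureTheory

open Polynomial in
/-- The monic Hermite polynomials for the weight `exp (-2 x ^ 2)`. -/
noncomputable def gaussPoly : ℕ → ℝ[X]
  | 0 => 1
  | k + 1 => X * gaussPoly k - C (1 / 4) * derivative (gaussPoly k)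

open Polynomial in
theorem gaussPoly_monic_natDegree (k : ℕ) :
    (gaussPoly k).Monic ∧ (gaussPoly k).natDegree = k := by
  induction k with
  | zero => simp [gaussPoly]
  | succ k ih =>
    obtain ⟨hm, hd⟩ := ih
    have hX : (X * gaussPoly k).Monic := monic_X.mul hm
    have hXd : (X * gaussPoly k).natDegree = k + 1 := by
      rw [natDegree_X_mul hm.ne_zero, hd]
    have hlt : (C (1 / 4) * derivative (gaussPoly k)).natDegree < (X * gaussPoly k).natDegree := by
      have h1 := natDegree_C_mul_le (1 / 4 : ℝ) (derivative (gaussPoly k))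
      have h2 := natDegree_derivative_le (gaussPoly k)
      omega
    refine ⟨hX.sub_of_left (degree_lt_degree hlt), ?_⟩
    rw [gaussPoly, natDegree_sub_eq_left_of_natDegree_lt hlt, hXd]

open Polynomial in
theorem derivative_gaussPoly_succ (k : ℕ) :
    derivative (gaussPoly (k + 1)) = C ((k : ℝ) + 1) * gaussPoly k := by
  induction k with
  | zero => simp [gaussPoly]
  | succ k ih =>
    rw [gaussPoly, derivative_sub, derivative_mul, derivative_C_mul, ih, derivative_C_mul]
    conv_rhs => rw [gaussPoly]
    have : gaussPoly (k + 1) = X * gaussPoly k - C (1 / 4) * derivative (gaussPoly k) := rfl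
    rw [derivative_X, one_mul, this]
    push_cast
    simp only [map_add, map_one]
    ring

theorem integrable_polynomial_mul_exp (p : Polynomial ℝ) :
    Integrable fun x : ℝ => p.eval x * Real.exp (-2 * x ^ 2) := by
  induction p using Polynomial.induction_on' with
  | add p q hp hq =>
    exact (hp.add hq).congr (.of_forall fun x => by simp [add_mul])
  | monomial k a =>
    have h := (integrable_rpow_mul_exp_neg_mul_sq (b := 2) (by norm_num) (s := k)
      (by linarith [Nat.cast_nonneg (α := ℝ) k])).const_mul a
    simpa [mul_assoc] using h

/-- Integration by parts against the Gaussian weight. -/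
theorem integral_gaussPoly_succ_mul (k : ℕ) (q : Polynomial ℝ) :
    ∫ x : ℝ, (gaussPoly (k + 1) * q).eval x * Real.exp (-2 * x ^ 2) =
      1 / 4 * ∫ x : ℝ, (gaussPoly k * q.derivative).eval x * Real.exp (-2 * x ^ 2) := by
  have hv (x : ℝ) : HasDerivAt (fun x => (gaussPoly k).eval x * Real.exp (-2 * x ^ 2))
      (-4 * ((gaussPoly (k + 1)).eval x * Real.exp (-2 * x ^ 2))) x := by
    have h := ((gaussPoly k).hasDerivAt x).mul (((hasDerivAt_pow 2 x).const_mul (-2)).exp)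
    convert! h using 1
    simp [gaussPoly]
    ring
  have key := integral_mul_deriv_eq_deriv_mul_of_integrable (u := fun x => q.eval x)
    (u' := fun x => q.derivative.eval x) (fun x _ => q.hasDerivAt x) (fun x _ => hv x)
    (by
      have := (integrable_polynomial_mul_exp (q * gaussPoly (k + 1))).const_mul (-4)
      refine this.congr (.of_forall fun x => ?_)
      simp
      ring)
    (by
      refine (integrable_polynomial_mul_exp (q.derivative * gaussPoly k)).congr
        (.of_forall fun x => ?_)
      simp
      ring)
    (by
      refine (integrable_polynomial_mul_exp (q * gaussPoly k)).congr
        (.of_forall fun x => ?_)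
      simp
      ring)
  have h1 : ∫ x : ℝ, q.eval x * (-4 * ((gaussPoly (k + 1)).eval x * Real.exp (-2 * x ^ 2))) =
      -4 * ∫ x : ℝ, (gaussPoly (k + 1) * q).eval x * Real.exp (-2 * x ^ 2) := by
    rw [← integral_const_mul]
    congr 1
    ext x
    simp
    ring
  have h2 : ∫ x : ℝ, q.derivative.eval x * ((gaussPoly k).eval x * Real.exp (-2 * x ^ 2)) =
      ∫ x : ℝ, (gaussPoly k * q.derivative).eval x * Real.exp (-2 * x ^ 2) := by
    congr 1
    ext x
    simp
    ring
  rw [h1, h2] at key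
  linarith

theorem integral_gaussPoly_mul_gaussPoly (k l : ℕ) :
    ∫ x : ℝ, (gaussPoly k * gaussPoly l).eval x * Real.exp (-2 * x ^ 2) =
      if k = l then (k.factorial : ℝ) / 4 ^ k * √(Real.pi / 2) else 0 := by
  induction k generalizing l with
  | zero =>
    cases l with
    | zero => simpa [gaussPoly] using integral_gaussian 2
    | succ l =>
      rw [mul_comm, integral_gaussPoly_succ_mul]
      simp [gaussPoly]
  | succ k ih =>
    rw [integral_gaussPoly_succ_mul]
    cases l with
    | zero => simp [gaussPoly]
    | succ l =>
      have h : ∫ x : ℝ, (gaussPoly k * (gaussPoly (l + 1)).derivative).eval x *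
          Real.exp (-2 * x ^ 2) =
          ((l : ℝ) + 1) * ∫ x : ℝ, (gaussPoly k * gaussPoly l).eval x * Real.exp (-2 * x ^ 2) := by
        rw [← integral_const_mul, derivative_gaussPoly_succ]
        congr 1
        ext x
        simp
        ring
      rw [h, ih]
      by_cases hkl : k = l
      · subst hkl
        simp [Nat.factorial_succ, pow_succ]
        ring
      · simp [hkl]

theorem integral_gaussPoly_mul_derivative (k l : ℕ) :
    ∫ x : ℝ, (gaussPoly k * (gaussPoly l).derivative).eval x * Real.exp (-2 * x ^ 2) =
      if l = k + 1 then ((k + 1).factorial : ℝ) / 4 ^ k * √(Real.pi / 2) else 0 := by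
  have h := integral_gaussPoly_succ_mul k (gaussPoly l)
  rw [integral_gaussPoly_mul_gaussPoly] at h
  by_cases hkl : l = k + 1
  · subst hkl
    simp only [if_true] at h ⊢
    rw [pow_succ] at h
    field_simp at h ⊢
    linarith
  · rw [if_neg (Ne.symm hkl)] at h
    rw [if_neg hkl]
    linarith

theorem prod_prod_gt_finProdFinEquiv {n : ℕ} (x : Fin n → ℝ) (h : ℝ) :
    ∏ p : Fin (n * 2), ∏ q ∈ Ioi p,
      ((x (finProdFinEquiv.symm q).1 + (finProdFinEquiv.symm q).2 * h) -
        (x (finProdFinEquiv.symm p).1 + (finProdFinEquiv.symm p).2 * h)) =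
      h ^ n * ∏ a : Fin n, ∏ b ∈ Ioi a,
        ((x b - x a) ^ 2 * (x b - x a + h) * (x b - x a - h)) := by
  have hlt (a b : Fin n) (s t : Fin 2) : finProdFinEquiv (a, s) < finProdFinEquiv (b, t) ↔
      a < b ∨ a = b ∧ s < t := by
    simp only [Fin.lt_def, finProdFinEquiv_apply_val, Fin.ext_iff]
    omega
  have hpow : h ^ n = ∏ a : Fin n, ∏ b : Fin n, if a = b then h else 1 := by simp
  simp only [← filter_lt_eq_Ioi, prod_filter]
  rw [hpow, ← prod_mul_distrib, ← finProdFinEquiv.prod_comp, Fintype.prod_prod_type]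
  refine prod_congr rfl fun a _ => ?_
  rw [Fin.prod_univ_two, ← finProdFinEquiv.prod_comp, ← finProdFinEquiv.prod_comp,
    Fintype.prod_prod_type, Fintype.prod_prod_type, ← prod_mul_distrib, ← prod_mul_distrib]
  refine prod_congr rfl fun b _ => ?_
  simp only [Fin.prod_univ_two, Equiv.symm_apply_apply, hlt]
  rcases lt_trichotomy a b with hab | rfl | hab
  · simp [hab, hab.ne]
    ring
  · simp
  · simp [hab.not_gt, hab.ne']

open Polynomial in
/-- The confluent Vandermonde determinant with every node doubled. -/
theorem det_confluent_vandermonde {n : ℕ} (x : Fin n → ℝ) (P : ℕ → ℝ[X])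
    (hP : ∀ k, (P k).Monic ∧ (P k).natDegree = k) :
    (Matrix.of fun q r : Fin n × Fin 2 =>
      (derivative^[q.2] (P (r.2 + 2 * r.1))).eval (x q.1)).det =
      ∏ a : Fin n, ∏ b ∈ Ioi a, (x b - x a) ^ 4 := by
  set N : ℝ → Matrix (Fin n × Fin 2) (Fin n × Fin 2) ℝ := fun h => Matrix.of fun q r =>
    if q.2 = 0 then (P (r.2 + 2 * r.1)).eval (x q.1)
    else h⁻¹ * ((P (r.2 + 2 * r.1)).eval (x q.1 + h) - (P (r.2 + 2 * r.1)).eval (x q.1)) with hN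
  have hdet (h : ℝ) (hh : h ≠ 0) : (N h).det = ∏ a : Fin n, ∏ b ∈ Ioi a,
        ((x b - x a) ^ 2 * (x b - x a + h) * (x b - x a - h)) := by
    set B : Matrix (Fin n × Fin 2) (Fin n × Fin 2) ℝ :=
      (Matrix.blockDiagonal fun _ : Fin n => !![1, 0; 1, h]).submatrix
        (Equiv.prodComm _ _) (Equiv.prodComm _ _) with hB
    have hBdet : B.det = h ^ n := by
      rw [hB, Matrix.det_submatrix_equiv_self, Matrix.det_blockDiagonal]
      simp
    have hBN : B * N h = Matrix.of fun q r : Fin n × Fin 2 =>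
        (P (r.2 + 2 * r.1)).eval (x q.1 + q.2 * h) := by
      ext ⟨i, s⟩ r
      simp only [Matrix.mul_apply, Fintype.sum_prod_type, hB, hN, Matrix.submatrix_apply,
        Matrix.blockDiagonal_apply, Equiv.prodComm_apply, Prod.swap, Matrix.of_apply,
        Fin.sum_univ_two]
      fin_cases s <;> simp [Finset.sum_add_distrib, hh]
    have hV := Matrix.det_eval_matrixOfPolynomials_eq_det_vandermonde
      (fun q : Fin (n * 2) => x (finProdFinEquiv.symm q).1 + (finProdFinEquiv.symm q).2 * h)
      (fun q => P q) (fun q => (hP q).2) (fun q => (hP q).1)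
    rw [Matrix.det_vandermonde, prod_prod_gt_finProdFinEquiv,
      ← Matrix.det_submatrix_equiv_self finProdFinEquiv] at hV
    have hM : ((Matrix.of fun i j : Fin (n * 2) => (P j).eval
        (x (finProdFinEquiv.symm i).1 + (finProdFinEquiv.symm i).2 * h)).submatrix
        finProdFinEquiv finProdFinEquiv) = B * N h := by
      rw [hBN]
      ext q r
      simp only [Matrix.submatrix_apply, Matrix.of_apply, Equiv.symm_apply_apply,
        finProdFinEquiv_apply_val]
    rw [hM, Matrix.det_mul, hBdet] at hV
    exact (mul_left_cancel₀ (pow_ne_zero n hh) hV).symm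
  have hlim : Filter.Tendsto N (nhdsWithin 0 {0}ᶜ) (nhds (Matrix.of fun q r : Fin n × Fin 2 =>
      (derivative^[q.2] (P (r.2 + 2 * r.1))).eval (x q.1))) := by
    refine tendsto_pi_nhds.2 fun ⟨i, s⟩ => tendsto_pi_nhds.2 fun r => ?_
    fin_cases s
    · simp [hN]
    · simpa [hN] using hasDerivAt_iff_tendsto_slope_zero.1
        ((P (r.2 + 2 * r.1)).hasDerivAt (x i))
  have hl := ((Continuous.matrix_det continuous_id).tendsto _).comp hlim
  refine tendsto_nhds_unique hl ?_
  have hc : Continuous fun h : ℝ => ∏ a : Fin n, ∏ b ∈ Ioi a,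
        ((x b - x a) ^ 2 * (x b - x a + h) * (x b - x a - h)) := by fun_prop
  have h0 := (hc.tendsto 0).mono_left (nhdsWithin_le_nhds (s := {0}ᶜ))
  have he : ∏ a : Fin n, ∏ b ∈ Ioi a, ((x b - x a) ^ 2 * (x b - x a + 0) * (x b - x a - 0)) =
      ∏ a : Fin n, ∏ b ∈ Ioi a, (x b - x a) ^ 4 := by
    refine prod_congr rfl fun a _ => prod_congr rfl fun b _ => by ring
  rw [he] at h0
  refine h0.congr' ?_
  filter_upwards [self_mem_nhdsWithin] with h hh
  exact (hdet h hh).symm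

/-- A permutation of `2 * n` sites that places every pair on consecutive sites `k, k + 1`
permutes the dominoes. -/
theorem exists_prodCongrLeft_of_consecutive {n : ℕ} (σ : Equiv.Perm (Fin n × Fin 2))
    (h : ∀ i, ((σ (i, 1)).2 + 2 * (σ (i, 1)).1 : ℕ) = (σ (i, 0)).2 + 2 * (σ (i, 0)).1 + 1) :
    ∃ τ : Equiv.Perm (Fin n), Equiv.prodCongrLeft (fun _ : Fin 2 => τ) = σ := by
  have hpair {i j : Fin n} (hij : σ (i, 0) = (j, 0)) : σ (i, 1) = (j, 1) := by
    have hi := h i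
    rw [hij] at hi
    ext <;> simp at hi ⊢ <;> omega
  have hzero (j : Fin n) : ∃ i, σ (i, 0) = (j, 0) := by
    induction j using WellFoundedLT.induction with
    | ind j ih =>
    obtain ⟨⟨i, s⟩, hi⟩ := σ.surjective (j, 0)
    fin_cases s
    · exact ⟨i, hi⟩
    · have hc := h i
      simp only [Fin.mk_one] at hi
      rw [hi] at hc
      obtain ⟨j', s', hj'⟩ : ∃ j' s', σ (i, 0) = (j', s') := ⟨_, _, rfl⟩
      rw [hj'] at hc
      have hlt : j' < j := by
        simp only [Fin.lt_def]
        simp at hc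
        omega
      have hs' : s' = 1 := by
        simp at hc
        omega
      obtain ⟨i', hi'⟩ := ih j' hlt
      have := σ.injective ((hpair hi').trans (hs' ▸ hj'.symm))
      simp at this
  choose ρ hρ using hzero
  have hinj : Function.Injective ρ := fun a b hab => by
    have := (hρ a).symm.trans (hab ▸ hρ b)
    simpa using this
  have hbij := Finite.injective_iff_bijective.1 hinj
  refine ⟨(Equiv.ofBijective ρ hbij).symm, Equiv.ext fun ⟨i, s⟩ => ?_⟩
  obtain ⟨j, rfl⟩ := hbij.2 i
  rw [Equiv.prodCongrLeft_apply, Equiv.ofBijective_symm_apply_apply]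
  fin_cases s
  · exact (hρ j).symm
  · exact (hpair (hρ j)).symm

theorem sum_sign_mul_prod_consecutive {n : ℕ} (A : ℕ → ℕ → ℝ)
    (hA : ∀ k l, l ≠ k + 1 → A k l = 0) :
    ∑ σ : Equiv.Perm (Fin n × Fin 2), ((Equiv.Perm.sign σ : ℤ) : ℝ) *
      ∏ i, A ((σ (i, 0)).2 + 2 * (σ (i, 0)).1) ((σ (i, 1)).2 + 2 * (σ (i, 1)).1) =
      n.factorial * ∏ j ∈ range n, A (2 * j) (2 * j + 1) := by
  rw [← Fintype.sum_of_injective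
    (fun τ : Equiv.Perm (Fin n) => Equiv.prodCongrLeft fun _ : Fin 2 => τ) ?_
    (fun _ => ∏ j ∈ range n, A (2 * j) (2 * j + 1))]
  · simp [Fintype.card_perm]
  · intro σ hσ
    by_contra hne
    refine hσ (exists_prodCongrLeft_of_consecutive σ fun i => ?_)
    by_contra hi
    exact hne (mul_eq_zero_of_right _ (prod_eq_zero (mem_univ i) (hA _ _ hi)))
  · intro τ
    rw [Equiv.Perm.sign_prodCongrLeft, prod_range]
    simp only [Equiv.prodCongrLeft_apply, prod_const, card_univ, Fintype.card_fin,
      Int.units_sq, Units.val_one, Int.cast_one, one_mul]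
    rw [← Equiv.prod_comp τ]
    simp [add_comm]
  · intro τ₁ τ₂ h
    ext i
    simpa using congrArg (fun e => ((e (i, 0)).1 : ℕ)) h

theorem factorial_mul_prod_factorial_eq_prod_Gamma (n : ℕ) :
    (n.factorial : ℝ) *
        ∏ j ∈ range n, (((2 * j + 1).factorial : ℝ) / 4 ^ (2 * j) * √(Real.pi / 2)) =
      (2 : ℝ) ^ (-((n : ℝ) * (2 * (n : ℝ) - 1 / 2))) * Real.pi ^ ((n : ℝ) / 2) *
        ∏ j ∈ Finset.Icc 1 n, Real.Gamma (2 * (j : ℝ) + 1) := by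
  induction n with
  | zero => simp
  | succ n ih =>
    have h2 : (2 : ℝ) ^ (-(((n + 1 : ℕ) : ℝ) * (2 * ((n + 1 : ℕ) : ℝ) - 1 / 2))) =
        2 ^ (-((n : ℝ) * (2 * (n : ℝ) - 1 / 2))) * (2 * 4 ^ (2 * n) * √2)⁻¹ := by
      rw [Real.sqrt_eq_rpow, show (4 : ℝ) ^ (2 * n) = 2 ^ (4 * n : ℝ) by
        rw [show (4 : ℝ) * n = ((4 * n : ℕ) : ℝ) by push_cast; ring, Real.rpow_natCast,
          show (4 : ℝ) = 2 ^ 2 by norm_num, ← pow_mul]; congr 1; ring]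
      rw [show (2 : ℝ) * 2 ^ (4 * n : ℝ) = 2 ^ (1 + 4 * n : ℝ) by
          rw [Real.rpow_add two_pos, Real.rpow_one], ← Real.rpow_add two_pos, ← Real.rpow_neg two_pos.le,
        ← Real.rpow_add two_pos]
      congr 1
      push_cast
      ring
    have hpi : Real.pi ^ (((n + 1 : ℕ) : ℝ) / 2) = Real.pi ^ ((n : ℝ) / 2) * √Real.pi := by
      rw [Real.sqrt_eq_rpow, ← Real.rpow_add Real.pi_pos]
      congr 1
      push_cast
      ring
    have hG : Real.Gamma (2 * ((n + 1 : ℕ) : ℝ) + 1) =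
        2 * ((n : ℝ) + 1) * ((2 * n + 1).factorial : ℝ) := by
      rw [show 2 * ((n + 1 : ℕ) : ℝ) = ((2 * n + 1 + 1 : ℕ) : ℝ) by push_cast; ring,
        Real.Gamma_nat_eq_factorial, Nat.factorial_succ (2 * n + 1)]
      push_cast
      ring
    rw [prod_range_succ, prod_Icc_succ_top (by omega), h2, hpi, hG, Nat.factorial_succ,
      Real.sqrt_div Real.pi_pos.le]
    have hs : √(2 : ℝ) ≠ 0 := by positivity
    push_cast
    rw [Real.sqrt_div Real.pi_pos.le] at ih
    calc _ = ((n : ℝ) + 1) * ((2 * n + 1).factorial / 4 ^ (2 * n) * (√Real.pi / √2)) *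
        (n.factorial * ∏ j ∈ range n,
          (((2 * j + 1).factorial : ℝ) / 4 ^ (2 * j) * (√Real.pi / √2))) := by ring
      _ = _ := by
        rw [ih]
        field_simp

/-- The Leibniz expansion of the confluent Vandermonde determinant, against the Gaussian weight. -/
theorem exp_mul_prod_sub_pow_four {n : ℕ} (E : Fin n → ℝ) :
    Real.exp (-(2 * ∑ j : Fin n, E j ^ 2)) *
        (∏ a : Fin n, ∏ b ∈ Finset.Ioi a, (E a - E b)) ^ 4 =
      ∑ σ : Equiv.Perm (Fin n × Fin 2), ((Equiv.Perm.sign σ : ℤ) : ℝ) *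
        ∏ i, ((gaussPoly ((σ (i, 0)).2 + 2 * (σ (i, 0)).1) *
          (gaussPoly ((σ (i, 1)).2 + 2 * (σ (i, 1)).1)).derivative).eval (E i) *
            Real.exp (-2 * E i ^ 2)) := by
  have hdet := det_confluent_vandermonde E gaussPoly gaussPoly_monic_natDegree
  have hsymm : (∏ a : Fin n, ∏ b ∈ Finset.Ioi a, (E a - E b)) ^ 4 =
      ∏ a : Fin n, ∏ b ∈ Ioi a, (E b - E a) ^ 4 := by
    simp only [← prod_pow]
    exact prod_congr rfl fun a _ => prod_congr rfl fun b _ => by ring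
  rw [hsymm, ← hdet, ← Matrix.det_transpose, Matrix.det_apply', mul_sum]
  refine sum_congr rfl fun σ _ => ?_
  rw [prod_mul_distrib, ← Real.exp_sum, ← mul_sum, Fintype.prod_prod_type, neg_mul]
  simp only [Fin.prod_univ_two, Matrix.transpose_apply, Matrix.of_apply, Polynomial.eval_mul,
    Fin.val_zero, Fin.val_one, Function.iterate_zero, Function.iterate_one, id]
  ring

/-- The Mehta-type Selberg integral for β = 4 (Eq. (C.7) of the paper). -/
theorem mehta_integral_beta_four (n : ℕ) (hn : 1 ≤ n) :
    ∫ E : Fin n → ℝ,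
        Real.exp (-(2 * ∑ j : Fin n, E j ^ 2)) *
          (∏ a : Fin n, ∏ b ∈ Finset.Ioi a, (E a - E b)) ^ 4
      = (2 : ℝ) ^ (-((n : ℝ) * (2 * (n : ℝ) - 1 / 2))) * Real.pi ^ ((n : ℝ) / 2) *
        ∏ j ∈ Finset.Icc 1 n, Real.Gamma (2 * (j : ℝ) + 1) := by
  simp_rw [exp_mul_prod_sub_pow_four]
  rw [integral_finsetSum]
  swap
  · intro σ _
    exact (Integrable.fintype_prod (f := fun (i : Fin n) (x : ℝ) =>
      (gaussPoly ((σ (i, 0)).2 + 2 * (σ (i, 0)).1) *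
        (gaussPoly ((σ (i, 1)).2 + 2 * (σ (i, 1)).1)).derivative).eval x *
          Real.exp (-2 * x ^ 2)) fun i => integrable_polynomial_mul_exp _).const_mul _
  simp_rw [integral_const_mul]
  have hprod (σ : Equiv.Perm (Fin n × Fin 2)) := integral_fintype_prod_volume_eq_prod
    fun (i : Fin n) (x : ℝ) => (gaussPoly ((σ (i, 0)).2 + 2 * (σ (i, 0)).1) *
      (gaussPoly ((σ (i, 1)).2 + 2 * (σ (i, 1)).1)).derivative).eval x * Real.exp (-2 * x ^ 2)
  simp_rw [hprod, integral_gaussPoly_mul_derivative]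
  rw [sum_sign_mul_prod_consecutive (fun k l => if l = k + 1 then
    ((k + 1).factorial : ℝ) / 4 ^ k * √(Real.pi / 2) else 0) fun k l hkl => if_neg hkl]
  simp only [if_true]
  exact factorial_mul_prod_factorial_eq_prod_Gamma n
end

section
/- Let n ≥ 1 and let f : Sym(n) → ℂ be integrable with respect to d[H] and invariant under conjugation by orthogonal matrices, i.e. f(OHOᵀ) = f(H) for every H ∈ Sym(n) and every real orthogonal O. Then ∫_{Sym(n)} f(H) d[H] = g_n · ∫_{ℝ^n} f(diag(E_1,…,E_n)) · ∏_{1≤a<b≤n} |E_a − E_b| dE, where g_n = (1/n!) · ∏_{j=1}^{n} π^{(j−1)/2} Γ(1/2)/Γ(j/2). -/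
open Finset MeasureTheory Matrix

/-- The index set of entries strictly above the diagonal of an `n × n` matrix. -/
abbrev UpperIdx (n : ℕ) := { p : Fin n × Fin n // p.1 < p.2 }

/-- The real symmetric matrix with diagonal entries `dg` and entries `u` above the diagonal.
Integrating a function of this matrix over Lebesgue measure in the coordinates `(dg, u)`
realizes the flat measure `d[H]` on `Sym(n)`. -/
noncomputable def symOf {n : ℕ} (dg : Fin n → ℝ) (u : UpperIdx n → ℝ) :
    Matrix (Fin n) (Fin n) ℝ :=
  Matrix.of fun i j =>
    if h : i < j then u ⟨(i, j), h⟩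
    else if h' : j < i then u ⟨(j, i), h'⟩
    else dg i

local instance {m n : Type*} : MeasurableSpace (Matrix m n ℝ) := MeasurableSpace.pi

local instance {m n : Type*} [Countable m] [Countable n] : BorelSpace (Matrix m n ℝ) :=
  inferInstanceAs (BorelSpace (m → n → ℝ))

local instance {m n : Type*} [Countable m] [Countable n] :
    SecondCountableTopology (Matrix m n ℝ) :=
  inferInstanceAs (SecondCountableTopology (m → n → ℝ))

/-! ### Bordered matrices -/

/-- The matrix with corner entry `a`, remaining first row `r`, remaining first column `c` and
lower right block `D`. -/
def bordered {m : ℕ} (a : ℝ) (r c : Fin m → ℝ) (D : Matrix (Fin m) (Fin m) ℝ) :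
    Matrix (Fin (m + 1)) (Fin (m + 1)) ℝ :=
  Matrix.of (Fin.cons (Fin.cons a r) fun i => Fin.cons (c i) (D i))

section Bordered

variable {m : ℕ}

@[simp] lemma bordered_zero_zero (a : ℝ) (r c : Fin m → ℝ) (D : Matrix (Fin m) (Fin m) ℝ) :
    bordered a r c D 0 0 = a := rfl

@[simp] lemma bordered_zero_succ (a : ℝ) (r c : Fin m → ℝ) (D : Matrix (Fin m) (Fin m) ℝ)
    (j : Fin m) : bordered a r c D 0 j.succ = r j := rfl

@[simp] lemma bordered_succ_zero (a : ℝ) (r c : Fin m → ℝ) (D : Matrix (Fin m) (Fin m) ℝ)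
    (i : Fin m) : bordered a r c D i.succ 0 = c i := rfl

@[simp] lemma bordered_succ_succ (a : ℝ) (r c : Fin m → ℝ) (D : Matrix (Fin m) (Fin m) ℝ)
    (i j : Fin m) : bordered a r c D i.succ j.succ = D i j := rfl

lemma bordered_mul (a a' : ℝ) (r c r' c' : Fin m → ℝ) (D D' : Matrix (Fin m) (Fin m) ℝ) :
    bordered a r c D * bordered a' r' c' D' =
      bordered (a * a' + r ⬝ᵥ c') (a • r' + r ᵥ* D') (a' • c + D *ᵥ c')
        (vecMulVec c r' + D * D') := by
  ext i j
  refine Fin.cases ?_ (fun i => ?_) i <;> refine Fin.cases ?_ (fun j => ?_) j <;>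
    simp [Matrix.mul_apply, Fin.sum_univ_succ, dotProduct, vecMul, mulVec, vecMulVec_apply,
      mul_comm]

lemma transpose_bordered (a : ℝ) (r c : Fin m → ℝ) (D : Matrix (Fin m) (Fin m) ℝ) :
    (bordered a r c D)ᵀ = bordered a c r Dᵀ := by
  ext i j
  refine Fin.cases ?_ (fun i => ?_) i <;> refine Fin.cases ?_ (fun j => ?_) j <;> simp

lemma bordered_one : bordered 1 0 0 (1 : Matrix (Fin m) (Fin m) ℝ) = 1 := by
  ext i j
  refine Fin.cases ?_ (fun i => ?_) i <;> refine Fin.cases ?_ (fun j => ?_) j <;>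
    simp [Matrix.one_apply, Fin.succ_ne_zero, (Fin.succ_ne_zero _).symm]

lemma bordered_diagonal (a : ℝ) (E : Fin m → ℝ) :
    bordered a 0 0 (diagonal E) = diagonal (Fin.cons a E : Fin (m + 1) → ℝ) := by
  ext i j
  refine Fin.cases ?_ (fun i => ?_) i <;> refine Fin.cases ?_ (fun j => ?_) j <;>
    simp [Matrix.diagonal_apply, Fin.succ_ne_zero, (Fin.succ_ne_zero _).symm]

lemma bordered_mulVec_cons (a t : ℝ) (r c w : Fin m → ℝ) (D : Matrix (Fin m) (Fin m) ℝ) :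
    bordered a r c D *ᵥ (Fin.cons t w : Fin (m + 1) → ℝ) =
      Fin.cons (a * t + r ⬝ᵥ w) (t • c + D *ᵥ w) := by
  ext i
  refine Fin.cases ?_ (fun i => ?_) i <;>
    simp [mulVec, dotProduct, Fin.sum_univ_succ, mul_comm]

lemma cons_dotProduct_cons (a b : ℝ) (v w : Fin m → ℝ) :
    (Fin.cons a v : Fin (m + 1) → ℝ) ⬝ᵥ (Fin.cons b w : Fin (m + 1) → ℝ) = a * b + v ⬝ᵥ w := by
  simp [dotProduct, Fin.sum_univ_succ]

lemma continuous_bordered {X : Type*} [TopologicalSpace X] {a : X → ℝ} {r c : X → Fin m → ℝ}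
    {D : X → Matrix (Fin m) (Fin m) ℝ} (ha : Continuous a) (hr : Continuous r)
    (hc : Continuous c) (hD : Continuous D) :
    Continuous fun x => bordered (a x) (r x) (c x) (D x) := by
  refine continuous_matrix fun i j => ?_
  refine Fin.cases ?_ (fun i => ?_) i <;> refine Fin.cases ?_ (fun j => ?_) j <;>
    simp only [bordered_zero_zero, bordered_zero_succ, bordered_succ_zero, bordered_succ_succ]
  · exact ha
  · exact (continuous_apply j).comp hr
  · exact (continuous_apply i).comp hc
  · exact hD.matrix_elem i j

end Bordered

/-! ### Positive definite matrices -/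

section PosDef

variable {ι : Type*} [Fintype ι]

lemma measurableSet_posDef [DecidableEq ι] : MeasurableSet {M : Matrix ι ι ℝ | M.PosDef} := by
  have h : {M : Matrix ι ι ℝ | M.PosDef} =
      ({M | Mᵀ = M} ∩ ⋂ x : ι → ℝ, {M | 0 ≤ x ⬝ᵥ M *ᵥ x}) ∩ {M | M.det ≠ 0} := by
    ext M
    simp only [Set.mem_inter_iff, Set.mem_iInter, Set.mem_ofPred_eq]
    constructor
    · intro hM
      exact ⟨⟨by simpa using hM.isHermitian.eq, fun x => by
        simpa using hM.posSemidef.dotProduct_mulVec_nonneg x⟩, hM.det_pos.ne'⟩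
    · rintro ⟨⟨h1, h2⟩, h3⟩
      have hs : M.PosSemidef := PosSemidef.of_dotProduct_mulVec_nonneg
        (by rw [IsHermitian, conjTranspose_eq_transpose_of_trivial, h1]) (by simpa using h2)
      exact hs.posDef_iff_isUnit.2 ((isUnit_iff_isUnit_det _).2 (isUnit_iff_ne_zero.2 h3))
  rw [h]
  refine ((isClosed_eq (by fun_prop) (by fun_prop)).inter
    (isClosed_iInter fun x => ?_)).measurableSet.inter ?_
  · exact isClosed_le continuous_const (by fun_prop)
  · exact (isOpen_ne_fun (by fun_prop) continuous_const).measurableSet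

lemma exists_top_eigenvector [DecidableEq ι] [Nonempty ι] {M : Matrix ι ι ℝ} (hM : M.IsSymm) :
    ∃ (l : ℝ) (v : ι → ℝ), v ≠ 0 ∧ M *ᵥ v = l • v ∧ (l • (1 : Matrix ι ι ℝ) - M).PosSemidef := by
  have hH : M.IsHermitian := by
    rw [IsHermitian, conjTranspose_eq_transpose_of_trivial, hM.eq]
  obtain ⟨i, hi⟩ := Finite.exists_max hH.eigenvalues
  refine ⟨hH.eigenvalues i, hH.eigenvectorBasis i, ?_, hH.mulVec_eigenvectorBasis i, ?_⟩
  · intro h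
    have := hH.eigenvectorBasis.orthonormal.ne_zero i
    exact this (by ext j; exact congrFun h j)
  · have hU : IsUnit (hH.eigenvectorUnitary : Matrix ι ι ℝ) := Unitary.isUnit_coe
    have h1 : (hH.eigenvalues i • (1 : Matrix ι ι ℝ) - M) =
        (hH.eigenvectorUnitary : Matrix ι ι ℝ) *
          diagonal (fun j => hH.eigenvalues i - hH.eigenvalues j) *
          star (hH.eigenvectorUnitary : Matrix ι ι ℝ) := by
      have h2 : diagonal (fun j => hH.eigenvalues i - hH.eigenvalues j) =
        hH.eigenvalues i • (1 : Matrix ι ι ℝ) - diagonal hH.eigenvalues := by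
        ext a b
        by_cases hab : a = b <;> simp [hab]
      have h3 := hH.spectral_theorem
      rw [Unitary.conjStarAlgAut_apply] at h3
      rw [h2, mul_sub, sub_mul]
      refine congrArg₂ _ ?_ h3
      simp
    rw [h1, hU.posSemidef_star_right_conjugate_iff, posSemidef_diagonal_iff]
    intro j
    exact sub_nonneg.2 (hi j)

lemma posDef_conj_iff [DecidableEq ι] {A M : Matrix ι ι ℝ} (hA : A.det ≠ 0) :
    (A * M * Aᵀ).PosDef ↔ M.PosDef := by
  have hU : IsUnit A := (isUnit_iff_isUnit_det _).2 (isUnit_iff_ne_zero.2 hA)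
  rw [← hU.posDef_star_right_conjugate_iff (x := M), star_eq_conjTranspose,
    conjTranspose_eq_transpose_of_trivial]

end PosDef

/-! ### Coordinates on symmetric matrices -/

section Coordinates

variable {n : ℕ}

/-- The diagonal and the strictly upper triangular entries of a matrix. -/
def symCoords (H : Matrix (Fin n) (Fin n) ℝ) : (Fin n → ℝ) × (UpperIdx n → ℝ) :=
  (fun i => H i i, fun u => H u.1.1 u.1.2)

lemma isSymm_symOf (d : Fin n → ℝ) (u : UpperIdx n → ℝ) : (symOf d u).IsSymm := by
  ext i j
  rcases lt_trichotomy i j with h | rfl | h <;> simp [symOf, *, not_lt_of_gt]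

@[simp] lemma symCoords_symOf (p : (Fin n → ℝ) × (UpperIdx n → ℝ)) :
    symCoords (symOf p.1 p.2) = p := by
  ext i
  · simp [symCoords, symOf]
  · simp [symCoords, symOf, i.2]

lemma symOf_symCoords {H : Matrix (Fin n) (Fin n) ℝ} (hH : H.IsSymm) :
    symOf (symCoords H).1 (symCoords H).2 = H := by
  ext i j
  rcases lt_trichotomy i j with h | rfl | h
  · simp [symOf, symCoords, h]
  · simp [symOf, symCoords]
  · simp [symOf, symCoords, h, not_lt_of_gt, hH.apply i j]

lemma continuous_symCoords :
    Continuous (symCoords : Matrix (Fin n) (Fin n) ℝ → (Fin n → ℝ) × (UpperIdx n → ℝ)) := by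
  unfold symCoords
  fun_prop

lemma continuous_symOf :
    Continuous fun p : (Fin n → ℝ) × (UpperIdx n → ℝ) => symOf p.1 p.2 := by
  refine continuous_matrix fun i j => ?_
  unfold symOf
  simp only [of_apply]
  split_ifs <;> fun_prop

lemma symOf_add (d d' : Fin n → ℝ) (u u' : UpperIdx n → ℝ) :
    symOf (d + d') (u + u') = symOf d u + symOf d' u' := by
  ext i j
  simp only [symOf, of_apply, Matrix.add_apply, Pi.add_apply]
  split_ifs <;> rfl

lemma symOf_smul (c : ℝ) (d : Fin n → ℝ) (u : UpperIdx n → ℝ) :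
    symOf (c • d) (c • u) = c • symOf d u := by
  ext i j
  simp only [symOf, of_apply, Matrix.smul_apply, Pi.smul_apply]
  split_ifs <;> rfl

lemma symOf_const_sub (c : ℝ) (d : Fin n → ℝ) (u : UpperIdx n → ℝ) :
    symOf ((fun _ => c) - d) (0 - u) = c • (1 : Matrix (Fin n) (Fin n) ℝ) - symOf d u := by
  ext i j
  rcases lt_trichotomy i j with h | rfl | h
  · simp [symOf, h, h.ne]
  · simp [symOf]
  · simp [symOf, h, h.ne', not_lt_of_gt]

/-- The action `H ↦ A * H * Aᵀ` on symmetric matrices, in coordinates. -/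
noncomputable def symCongr (A : Matrix (Fin n) (Fin n) ℝ) :
    (Fin n → ℝ) × (UpperIdx n → ℝ) →ₗ[ℝ] (Fin n → ℝ) × (UpperIdx n → ℝ) where
  toFun p := symCoords (A * symOf p.1 p.2 * Aᵀ)
  map_add' p q := by
    simp only [Prod.fst_add, Prod.snd_add, symOf_add, mul_add, add_mul]
    rfl
  map_smul' c p := by
    simp only [Prod.smul_fst, Prod.smul_snd, symOf_smul, Matrix.mul_smul, Matrix.smul_mul]
    rfl

lemma Matrix.IsSymm.conj {H : Matrix (Fin n) (Fin n) ℝ} (hH : H.IsSymm)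
    (A : Matrix (Fin n) (Fin n) ℝ) : (A * H * Aᵀ).IsSymm := by
  rw [IsSymm, transpose_mul, transpose_mul, transpose_transpose, hH.eq, mul_assoc]

lemma symOf_symCongr (A : Matrix (Fin n) (Fin n) ℝ) (p : (Fin n → ℝ) × (UpperIdx n → ℝ)) :
    symOf (symCongr A p).1 (symCongr A p).2 = A * symOf p.1 p.2 * Aᵀ :=
  symOf_symCoords ((isSymm_symOf _ _).conj A)

lemma symCongr_mul (A B : Matrix (Fin n) (Fin n) ℝ) :
    symCongr (A * B) = symCongr A ∘ₗ symCongr B := by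
  refine LinearMap.ext fun p => ?_
  have h := symOf_symCongr B p
  change symCoords (A * B * symOf p.1 p.2 * (A * B)ᵀ) =
    symCoords (A * symOf (symCongr B p).1 (symCongr B p).2 * Aᵀ)
  rw [h, transpose_mul]
  simp only [mul_assoc]

lemma symCongr_one : symCongr (1 : Matrix (Fin n) (Fin n) ℝ) = LinearMap.id := by
  refine LinearMap.ext fun p => ?_
  change symCoords (1 * symOf p.1 p.2 * 1ᵀ) = p
  simp

lemma det_symCongr_mul (A B : Matrix (Fin n) (Fin n) ℝ) :
    LinearMap.det (symCongr (A * B)) = LinearMap.det (symCongr A) * LinearMap.det (symCongr B) := by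
  rw [symCongr_mul, LinearMap.det_comp]

lemma prod_upperIdx_mul (d : Fin n → ℝ) :
    ∏ u : UpperIdx n, d u.1.1 * d u.1.2 = (∏ i, d i) ^ (n - 1) := by
  have h1 : ∀ g : Fin n × Fin n → ℝ,
      ∏ u : UpperIdx n, g u.1 = ∏ i, ∏ j, if i < j then g (i, j) else 1 := by
    intro g
    rw [← Fintype.prod_prod_type' (fun i j => if i < j then g (i, j) else 1),
      ← Finset.prod_filter]
    exact (Finset.prod_subtype _ (by simp) _).symm
  rw [Finset.prod_mul_distrib, h1 fun p => d p.1, h1 fun p => d p.2]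
  rw [Finset.prod_comm (f := fun i j => if i < j then d (i, j).2 else 1), ← Finset.prod_mul_distrib,
    ← Finset.prod_pow]
  refine Finset.prod_congr rfl fun i _ => ?_
  rw [← Finset.prod_mul_distrib]
  have h2 : ∀ j : Fin n, ((if i < j then d i else 1) * if j < i then d i else 1) =
      if j ≠ i then d i else 1 := by
    intro j
    rcases lt_trichotomy i j with h | rfl | h
    · simp [h, h.ne', not_lt_of_gt]
    · simp
    · simp [h, h.ne, not_lt_of_gt]
  simp only [h2]
  rw [← Finset.prod_filter, Finset.prod_const, Finset.filter_ne', Finset.card_erase_of_mem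
    (Finset.mem_univ _), Finset.card_univ, Fintype.card_fin]

lemma det_symCongr_diagonal (d : Fin n → ℝ) :
    LinearMap.det (symCongr (diagonal d)) = (∏ i, d i) ^ (n + 1) := by
  have h : symCongr (diagonal d) =
      (Matrix.toLin' (diagonal fun i => d i * d i)).prodMap
        (Matrix.toLin' (diagonal fun u : UpperIdx n => d u.1.1 * d u.1.2)) := by
    refine LinearMap.ext fun p => ?_
    change symCoords (diagonal d * symOf p.1 p.2 * (diagonal d)ᵀ) = _
    ext i
    · simp [symCoords, symOf, mulVec_diagonal]
      ring
    · simp [symCoords, symOf, mulVec_diagonal, i.2]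
      ring
  rw [h, LinearMap.det_prodMap, LinearMap.det_toLin', LinearMap.det_toLin', det_diagonal,
    det_diagonal, prod_upperIdx_mul, Finset.prod_mul_distrib]
  rcases n with _ | n
  · simp
  · simp only [Nat.add_sub_cancel]
    ring

lemma det_symCongr {A : Matrix (Fin n) (Fin n) ℝ} (hA : A.IsSymm) :
    LinearMap.det (symCongr A) = A.det ^ (n + 1) := by
  have hH : A.IsHermitian := by
    rw [IsHermitian, conjTranspose_eq_transpose_of_trivial, hA.eq]
  have h3 := hH.spectral_theorem
  rw [Unitary.conjStarAlgAut_apply] at h3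
  set U : Matrix (Fin n) (Fin n) ℝ := ↑hH.eigenvectorUnitary
  have hU : U * star U = 1 := Unitary.coe_mul_star_self _
  have h4 : LinearMap.det (symCongr U) * LinearMap.det (symCongr (star U)) = 1 := by
    rw [← det_symCongr_mul, hU, symCongr_one, LinearMap.det_id]
  have h5 : A.det = ∏ i, hH.eigenvalues i := by simpa using hH.det_eq_prod_eigenvalues
  rw [h5, ← det_symCongr_diagonal]
  conv_lhs => rw [h3]
  rw [det_symCongr_mul, det_symCongr_mul, mul_right_comm, h4, one_mul]
  rfl

lemma lintegral_symOf_conj {A : Matrix (Fin n) (Fin n) ℝ} (hA : A.IsSymm) (hdet : A.det ≠ 0)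
    {h : Matrix (Fin n) (Fin n) ℝ → ENNReal} (hh : Measurable h) :
    ∫⁻ p : (Fin n → ℝ) × (UpperIdx n → ℝ), h (symOf p.1 p.2) =
      ENNReal.ofReal (|A.det| ^ (n + 1)) *
        ∫⁻ p : (Fin n → ℝ) × (UpperIdx n → ℝ), h (A * symOf p.1 p.2 * Aᵀ) := by
  have hd : LinearMap.det (symCongr A) ≠ 0 := by
    rw [det_symCongr hA]
    exact pow_ne_zero _ hdet
  have : (volume : Measure ((Fin n → ℝ) × (UpperIdx n → ℝ))).IsAddHaarMeasure :=
    Measure.prod.instIsAddHaarMeasure volume volume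
  have h1 := Measure.map_linearMap_addHaar_eq_smul_addHaar
    (volume : Measure ((Fin n → ℝ) × (UpperIdx n → ℝ))) hd
  have hm : Measurable fun p : (Fin n → ℝ) × (UpperIdx n → ℝ) => h (symOf p.1 p.2) :=
    hh.comp continuous_symOf.measurable
  have h2 : ∫⁻ p : (Fin n → ℝ) × (UpperIdx n → ℝ), h (A * symOf p.1 p.2 * Aᵀ) =
      ENNReal.ofReal |(LinearMap.det (symCongr A))⁻¹| *
        ∫⁻ p : (Fin n → ℝ) × (UpperIdx n → ℝ), h (symOf p.1 p.2) := by
    rw [← smul_eq_mul, ← lintegral_smul_measure, ← h1,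
      lintegral_map hm (LinearMap.continuous_of_finiteDimensional _).measurable]
    simp only [symOf_symCongr]
  rw [h2, ← mul_assoc, det_symCongr hA, ← abs_pow, ← ENNReal.ofReal_mul (abs_nonneg _), ← abs_mul,
    mul_inv_cancel₀ (pow_ne_zero _ hdet), abs_one, ENNReal.ofReal_one, one_mul]

lemma lintegral_symOf_const_sub (c : ℝ) (h : Matrix (Fin n) (Fin n) ℝ → ENNReal) :
    ∫⁻ p : (Fin n → ℝ) × (UpperIdx n → ℝ), h (c • (1 : Matrix (Fin n) (Fin n) ℝ) - symOf p.1 p.2) =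
      ∫⁻ p : (Fin n → ℝ) × (UpperIdx n → ℝ), h (symOf p.1 p.2) := by
  have h1 : MeasurePreserving (Prod.map (fun x => (fun _ => c) - x) (fun x => 0 - x))
      ((volume : Measure (Fin n → ℝ)).prod (volume : Measure (UpperIdx n → ℝ)))
      ((volume : Measure (Fin n → ℝ)).prod (volume : Measure (UpperIdx n → ℝ))) :=
    (Measure.measurePreserving_sub_left volume _).prod
      (Measure.measurePreserving_sub_left volume _)
  have h2 := h1.lintegral_comp_emb
    ((MeasurableEquiv.subLeft (fun _ : Fin n => c)).prodCongr
      (MeasurableEquiv.subLeft (0 : UpperIdx n → ℝ))).measurableEmbedding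
    fun p => h (symOf p.1 p.2)
  simp only [Prod.map_fst, Prod.map_snd, symOf_const_sub] at h2
  exact h2

end Coordinates

/-! ### Parametrizing the first row by the top eigenpair -/

section BorderMap

variable {m : ℕ}

/-- The first row `(a, b)` of the bordered matrix with lower right block `D` which has
eigenvalue `q.1` with eigenvector `(1, q.2)`. -/
def borderMap (D : Matrix (Fin m) (Fin m) ℝ) (q : ℝ × (Fin m → ℝ)) : ℝ × (Fin m → ℝ) :=
  (q.1 - q.2 ⬝ᵥ (q.1 • (1 : Matrix (Fin m) (Fin m) ℝ) - D) *ᵥ q.2,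
    (q.1 • (1 : Matrix (Fin m) (Fin m) ℝ) - D) *ᵥ q.2)

lemma Matrix.IsSymm.mulVec_dotProduct {ι : Type*} [Fintype ι] {M : Matrix ι ι ℝ} (hM : M.IsSymm)
    (x y : ι → ℝ) : M *ᵥ x ⬝ᵥ y = x ⬝ᵥ M *ᵥ y := by
  rw [dotProduct_mulVec, ← mulVec_transpose, hM.eq]

lemma isSymm_smul_one_sub {ι : Type*} [DecidableEq ι] {D : Matrix ι ι ℝ} (hD : D.IsSymm) (l : ℝ) :
    (l • (1 : Matrix ι ι ℝ) - D).IsSymm := by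
  rw [IsSymm, transpose_sub, transpose_smul, transpose_one, hD.eq]

lemma smul_one_sub_mulVec {ι : Type*} [Fintype ι] [DecidableEq ι] (D : Matrix ι ι ℝ) (l : ℝ)
    (x : ι → ℝ) : (l • (1 : Matrix ι ι ℝ) - D) *ᵥ x = l • x - D *ᵥ x := by
  rw [sub_mulVec, smul_mulVec, one_mulVec]

lemma borderMap_sub_form {D : Matrix (Fin m) (Fin m) ℝ} (hD : D.IsSymm)
    {p q : ℝ × (Fin m → ℝ)} (h : borderMap D p = borderMap D q) :
    (q.2 - p.2) ⬝ᵥ (p.1 • (1 : Matrix (Fin m) (Fin m) ℝ) - D) *ᵥ (q.2 - p.2) =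
      (p.1 - q.1) * (1 + q.2 ⬝ᵥ q.2) := by
  obtain ⟨l, x⟩ := p
  obtain ⟨l', x'⟩ := q
  simp only [borderMap, Prod.mk.injEq, smul_one_sub_mulVec] at h ⊢
  obtain ⟨h1, h2⟩ := h
  have e1 := congrArg (fun v => x' ⬝ᵥ v) h2
  have e2 := congrArg (fun v => x ⬝ᵥ v) h2
  have e3 := hD.mulVec_dotProduct x x'
  rw [dotProduct_comm] at e3
  simp only [mulVec_sub, dotProduct_sub, sub_dotProduct, dotProduct_smul, smul_eq_mul] at h1 e1 e2 ⊢
  rw [dotProduct_comm x' x] at *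
  linarith

lemma borderMap_injOn {D : Matrix (Fin m) (Fin m) ℝ} (hD : D.IsSymm) :
    Set.InjOn (borderMap D) {q | (q.1 • (1 : Matrix (Fin m) (Fin m) ℝ) - D).PosDef} := by
  intro p hp q hq h
  have e1 := borderMap_sub_form hD h
  have e2 := borderMap_sub_form hD h.symm
  have p1 : 0 ≤ (q.2 - p.2) ⬝ᵥ (p.1 • (1 : Matrix (Fin m) (Fin m) ℝ) - D) *ᵥ (q.2 - p.2) := by
    simpa using (Matrix.PosDef.posSemidef hp).dotProduct_mulVec_nonneg (q.2 - p.2)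
  have p2 : 0 ≤ (p.2 - q.2) ⬝ᵥ (q.1 • (1 : Matrix (Fin m) (Fin m) ℝ) - D) *ᵥ (p.2 - q.2) := by
    simpa using (Matrix.PosDef.posSemidef hq).dotProduct_mulVec_nonneg (p.2 - q.2)
  have n1 : 0 ≤ q.2 ⬝ᵥ q.2 := by simpa using dotProduct_star_self_nonneg q.2
  have n2 : 0 ≤ p.2 ⬝ᵥ p.2 := by simpa using dotProduct_star_self_nonneg p.2
  rw [e1] at p1
  rw [e2] at p2
  have h3 : p.1 = q.1 := by
    have := nonneg_of_mul_nonneg_left p1 (by positivity)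
    have := nonneg_of_mul_nonneg_left p2 (by positivity)
    linarith
  refine Prod.ext h3 ?_
  by_contra hne
  have h4 : 0 < (q.2 - p.2) ⬝ᵥ (p.1 • (1 : Matrix (Fin m) (Fin m) ℝ) - D) *ᵥ (q.2 - p.2) := by
    simpa using Matrix.PosDef.dotProduct_mulVec_pos hp (sub_ne_zero.2 (Ne.symm hne))
  rw [e1, h3, sub_self, zero_mul] at h4
  exact lt_irrefl _ h4

lemma mem_image_borderMap [Nonempty (Fin m)] {D : Matrix (Fin m) (Fin m) ℝ} (hD : D.IsSymm)
    {μ : ℝ} {u : Fin m → ℝ} (hu : D *ᵥ u = μ • u) (hu0 : u ≠ 0)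
    (hμ : (μ • (1 : Matrix (Fin m) (Fin m) ℝ) - D).PosSemidef) {a : ℝ} {b : Fin m → ℝ}
    (hb : b ⬝ᵥ u ≠ 0) :
    (a, b) ∈ borderMap D '' {q | (q.1 • (1 : Matrix (Fin m) (Fin m) ℝ) - D).PosDef} := by
  have hH : (bordered a b b D).IsSymm := by
    rw [IsSymm, transpose_bordered, hD.eq]
  obtain ⟨l, v, hv0, hv, hl⟩ := exists_top_eigenvector hH
  have key : ∀ w : Fin m → ℝ, (l • (1 : Matrix (Fin (m + 1)) (Fin (m + 1)) ℝ) -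
      bordered a b b D) *ᵥ (Fin.cons 0 w : Fin (m + 1) → ℝ) =
      Fin.cons (-(b ⬝ᵥ w)) ((l • (1 : Matrix (Fin m) (Fin m) ℝ) - D) *ᵥ w) := by
    intro w
    rw [smul_one_sub_mulVec, bordered_mulVec_cons, smul_one_sub_mulVec]
    ext i
    refine Fin.cases ?_ (fun i => ?_) i <;> simp
  have key2 : ∀ w : Fin m → ℝ, (Fin.cons 0 w : Fin (m + 1) → ℝ) ⬝ᵥ
      (l • (1 : Matrix (Fin (m + 1)) (Fin (m + 1)) ℝ) -
        bordered a b b D) *ᵥ (Fin.cons 0 w : Fin (m + 1) → ℝ) =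
      w ⬝ᵥ (l • (1 : Matrix (Fin m) (Fin m) ℝ) - D) *ᵥ w := by
    intro w
    rw [key, cons_dotProduct_cons, zero_mul, zero_add]
  have huu : 0 < u ⬝ᵥ u := by simpa using dotProduct_star_self_pos_iff.2 hu0
  have hform : u ⬝ᵥ (l • (1 : Matrix (Fin m) (Fin m) ℝ) - D) *ᵥ u = (l - μ) * (u ⬝ᵥ u) := by
    rw [smul_one_sub_mulVec, hu, ← sub_smul, dotProduct_smul, smul_eq_mul]
  have hle : 0 ≤ (l - μ) * (u ⬝ᵥ u) := by
    rw [← hform, ← key2]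
    simpa using hl.dotProduct_mulVec_nonneg (Fin.cons 0 u : Fin (m + 1) → ℝ)
  have hlt : μ < l := by
    refine lt_of_le_of_ne (sub_nonneg.1 (nonneg_of_mul_nonneg_left hle huu)) ?_
    rintro rfl
    have h0 := (hl.dotProduct_mulVec_zero_iff (Fin.cons 0 u : Fin (m + 1) → ℝ)).1
      (by rw [star_trivial, key2, hform, sub_self, zero_mul])
    rw [key] at h0
    exact hb (by simpa using congrFun h0 0)
  have hpd : (l • (1 : Matrix (Fin m) (Fin m) ℝ) - D).PosDef := by
    have h1 : l • (1 : Matrix (Fin m) (Fin m) ℝ) - D =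
        (l - μ) • (1 : Matrix (Fin m) (Fin m) ℝ) + (μ • (1 : Matrix (Fin m) (Fin m) ℝ) - D) := by
      rw [sub_smul]
      abel
    rw [h1]
    exact (PosDef.one.smul (sub_pos.2 hlt)).add_posSemidef hμ
  obtain ⟨t, w, rfl⟩ : ∃ (t : ℝ) (w : Fin m → ℝ), v = Fin.cons t w :=
    ⟨v 0, Fin.tail v, (Fin.cons_self_tail v).symm⟩
  rw [bordered_mulVec_cons] at hv
  have hv1 : a * t + b ⬝ᵥ w = l * t := by simpa using congrFun hv 0
  have hv2 : t • b + D *ᵥ w = l • w := by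
    ext i
    simpa using congrFun hv i.succ
  have ht : t ≠ 0 := by
    rintro rfl
    have hw : w ≠ 0 := by
      rintro rfl
      refine hv0 (funext fun i => ?_)
      refine Fin.cases ?_ (fun i => ?_) i <;> simp
    have h1 := hpd.dotProduct_mulVec_pos hw
    rw [zero_smul, zero_add] at hv2
    rw [smul_one_sub_mulVec, hv2, sub_self, dotProduct_zero] at h1
    exact lt_irrefl _ h1
  have h3 : (l • (1 : Matrix (Fin m) (Fin m) ℝ) - D) *ᵥ (t⁻¹ • w) = b := by
    rw [mulVec_smul, smul_one_sub_mulVec, ← hv2, add_sub_cancel_right, smul_smul,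
      inv_mul_cancel₀ ht, one_smul]
  refine ⟨(l, t⁻¹ • w), hpd, ?_⟩
  simp only [borderMap]
  rw [h3]
  refine Prod.ext ?_ rfl
  simp only [smul_dotProduct, smul_eq_mul]
  rw [dotProduct_comm w b]
  field_simp
  linarith

lemma ae_mem_image_borderMap {D : Matrix (Fin m) (Fin m) ℝ} (hD : D.IsSymm) :
    ∀ᵐ q : ℝ × (Fin m → ℝ),
      q ∈ borderMap D '' {q | (q.1 • (1 : Matrix (Fin m) (Fin m) ℝ) - D).PosDef} := by
  rcases isEmpty_or_nonempty (Fin m) with hm | hm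
  · refine Filter.Eventually.of_forall fun q => ⟨q, ?_, ?_⟩
    · exact PosDef.of_dotProduct_mulVec_pos (Subsingleton.elim _ _)
        fun x hx => (hx (Subsingleton.elim _ _)).elim
    · refine Prod.ext ?_ (Subsingleton.elim _ _)
      simp [borderMap, dotProduct]
  · obtain ⟨μ, u, hu0, hu, hμ⟩ := exists_top_eigenvector hD
    have : (volume : Measure (ℝ × (Fin m → ℝ))).IsAddHaarMeasure :=
      Measure.prod.instIsAddHaarMeasure volume volume
    let φ : ℝ × (Fin m → ℝ) →ₗ[ℝ] ℝ :=
      { toFun q := q.2 ⬝ᵥ u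
        map_add' p q := by simp [add_dotProduct]
        map_smul' c q := by simp [smul_dotProduct] }
    have hφ : LinearMap.ker φ ≠ ⊤ := by
      intro h
      have h1 : ((0 : ℝ), u) ∈ LinearMap.ker φ := h ▸ Submodule.mem_top
      exact hu0 (dotProduct_self_eq_zero.1 h1)
    rw [ae_iff]
    refine measure_mono_null (fun q hq => ?_) (Measure.addHaar_submodule volume _ hφ)
    by_contra hne
    exact hq (mem_image_borderMap hD hu hu0 hμ hne)

/-- The derivative of `borderMap`. -/
def borderDeriv (D : Matrix (Fin m) (Fin m) ℝ) (q : ℝ × (Fin m → ℝ)) :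
    ℝ × (Fin m → ℝ) →ₗ[ℝ] ℝ × (Fin m → ℝ) where
  toFun v := (v.1 * (1 - q.2 ⬝ᵥ q.2) -
      2 * ((q.1 • (1 : Matrix (Fin m) (Fin m) ℝ) - D) *ᵥ q.2 ⬝ᵥ v.2),
    v.1 • q.2 + (q.1 • (1 : Matrix (Fin m) (Fin m) ℝ) - D) *ᵥ v.2)
  map_add' v w := by
    refine Prod.ext ?_ ?_
    · simp only [Prod.fst_add, Prod.snd_add, dotProduct_add]
      ring
    · simp only [Prod.fst_add, Prod.snd_add, add_smul, mulVec_add]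
      abel
  map_smul' c v := by
    refine Prod.ext ?_ ?_
    · simp only [Prod.smul_fst, Prod.smul_snd, dotProduct_smul, smul_eq_mul, RingHom.id_apply]
      ring
    · simp only [Prod.smul_fst, Prod.smul_snd, mulVec_smul, smul_eq_mul, RingHom.id_apply,
        smul_add, smul_smul]

lemma hasFDerivAt_borderMap {D : Matrix (Fin m) (Fin m) ℝ} (hD : D.IsSymm)
    (q : ℝ × (Fin m → ℝ)) :
    HasFDerivAt (borderMap D) (LinearMap.toContinuousLinearMap (borderDeriv D q)) q := by
  have hd : DifferentiableAt ℝ (borderMap D) q := by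
    have h : borderMap D = fun q => (q.1 - ∑ i, q.2 i * (q.1 * q.2 i - ∑ j, D i j * q.2 j),
        fun i => q.1 * q.2 i - ∑ j, D i j * q.2 j) := by
      funext q
      simp only [borderMap, smul_one_sub_mulVec]
      rfl
    rw [h]
    fun_prop
  have h1 := hd.hasFDerivAt
  convert h1 using 1
  refine ContinuousLinearMap.ext fun v => ?_
  have h2 := h1.hasLineDerivAt v
  refine HasLineDerivAt.unique (x := q) (v := v) (f := borderMap D) (𝕜 := ℝ) ?_ h2
  obtain ⟨l, x⟩ := q
  obtain ⟨k, y⟩ := v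
  have e3 := hD.mulVec_dotProduct x y
  rw [dotProduct_comm] at e3
  have h3 : ∀ t : ℝ, borderMap D ((l, x) + t • (k, y)) =
      borderMap D (l, x) + t • borderDeriv D (l, x) (k, y) +
        t ^ 2 • ((y ⬝ᵥ D *ᵥ y - l * (y ⬝ᵥ y) - 2 * k * (x ⬝ᵥ y), k • y) : ℝ × (Fin m → ℝ)) +
        t ^ 3 • ((-k * (y ⬝ᵥ y), 0) : ℝ × (Fin m → ℝ)) := by
    intro t
    refine Prod.ext ?_ ?_
    · simp [borderMap, borderDeriv, smul_one_sub_mulVec, mulVec_add, mulVec_smul, dotProduct_add,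
        add_dotProduct, dotProduct_sub, sub_dotProduct, dotProduct_smul, smul_dotProduct]
      rw [dotProduct_comm y x, dotProduct_comm (D *ᵥ x) y, e3]
      ring
    · ext i
      simp [borderMap, borderDeriv, smul_one_sub_mulVec, mulVec_add, mulVec_smul]
      ring
  have h4 : HasDerivAt (fun t : ℝ => borderMap D (l, x) + t • borderDeriv D (l, x) (k, y) +
        t ^ 2 • ((y ⬝ᵥ D *ᵥ y - l * (y ⬝ᵥ y) - 2 * k * (x ⬝ᵥ y), k • y) : ℝ × (Fin m → ℝ)) +
        t ^ 3 • ((-k * (y ⬝ᵥ y), 0) : ℝ × (Fin m → ℝ))) (borderDeriv D (l, x) (k, y)) 0 := by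
    have := (((hasDerivAt_const (0 : ℝ) (borderMap D (l, x))).add
      ((hasDerivAt_id (0 : ℝ)).smul_const (borderDeriv D (l, x) (k, y)))).add
      ((hasDerivAt_pow 2 (0 : ℝ)).smul_const
        ((y ⬝ᵥ D *ᵥ y - l * (y ⬝ᵥ y) - 2 * k * (x ⬝ᵥ y), k • y) : ℝ × (Fin m → ℝ)))).add
      ((hasDerivAt_pow 3 (0 : ℝ)).smul_const ((-k * (y ⬝ᵥ y), 0) : ℝ × (Fin m → ℝ)))
    refine this.congr_deriv ?_
    simp
  unfold HasLineDerivAt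
  simp only [h3]
  exact h4

lemma det_borderDeriv {D : Matrix (Fin m) (Fin m) ℝ} (hD : D.IsSymm) {q : ℝ × (Fin m → ℝ)}
    (hq : (q.1 • (1 : Matrix (Fin m) (Fin m) ℝ) - D).PosDef) :
    LinearMap.det (borderDeriv D q) =
      (q.1 • (1 : Matrix (Fin m) (Fin m) ℝ) - D).det * (1 + q.2 ⬝ᵥ q.2) := by
  have hM := isSymm_smul_one_sub hD q.1
  set M := q.1 • (1 : Matrix (Fin m) (Fin m) ℝ) - D with hMdef
  let b := (Module.Basis.singleton Unit ℝ).prod (Pi.basisFun ℝ (Fin m))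
  have h1 : LinearMap.toMatrix b b (borderDeriv D q) =
      fromBlocks (of fun _ _ => 1 - q.2 ⬝ᵥ q.2) (of fun _ j => -2 * (M *ᵥ q.2) j)
        (of fun i _ => q.2 i) M := by
    ext i j
    rw [LinearMap.toMatrix_apply]
    rcases i with i | i <;> rcases j with j | j <;>
      simp [b, borderDeriv, ← hMdef]
  have : Invertible M := hq.isUnit.invertible
  rw [← LinearMap.det_toMatrix b, h1, det_fromBlocks₂₂]
  congr 1
  rw [det_unique]
  simp only [Matrix.sub_apply, of_apply, invOf_eq_nonsing_inv]
  have h2 : ((of fun (_ : Unit) j => -2 * (M *ᵥ q.2) j) * M⁻¹ * (of fun i (_ : Unit) => q.2 i))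
      default default = (((-2 : ℝ) • (M *ᵥ q.2)) ᵥ* M⁻¹) ⬝ᵥ q.2 := rfl
  rw [h2, smul_vecMul, ← vecMul_transpose, hM.eq, vecMul_vecMul, mul_nonsing_inv _
    ((isUnit_iff_isUnit_det _).1 hq.isUnit), vecMul_one, smul_dotProduct, smul_eq_mul]
  ring

lemma measurableSet_posDef_smul_one_sub (D : Matrix (Fin m) (Fin m) ℝ) :
    MeasurableSet {q : ℝ × (Fin m → ℝ) | (q.1 • (1 : Matrix (Fin m) (Fin m) ℝ) - D).PosDef} := by
  have h : Continuous fun q : ℝ × (Fin m → ℝ) => q.1 • (1 : Matrix (Fin m) (Fin m) ℝ) - D := by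
    fun_prop
  exact h.measurable measurableSet_posDef

lemma lintegral_borderMap {D : Matrix (Fin m) (Fin m) ℝ} (hD : D.IsSymm)
    (h : ℝ × (Fin m → ℝ) → ENNReal) :
    ∫⁻ q, h q = ∫⁻ q in {q | (q.1 • (1 : Matrix (Fin m) (Fin m) ℝ) - D).PosDef},
      ENNReal.ofReal ((q.1 • (1 : Matrix (Fin m) (Fin m) ℝ) - D).det * (1 + q.2 ⬝ᵥ q.2)) *
        h (borderMap D q) := by
  have : (volume : Measure (ℝ × (Fin m → ℝ))).IsAddHaarMeasure :=
    Measure.prod.instIsAddHaarMeasure volume volume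
  have h1 := lintegral_image_eq_lintegral_abs_det_fderiv_mul volume
    (measurableSet_posDef_smul_one_sub D)
    (fun q _ => (hasFDerivAt_borderMap hD q).hasFDerivWithinAt) (borderMap_injOn hD) h
  rw [Measure.restrict_eq_self_of_ae_mem (ae_mem_image_borderMap hD)] at h1
  rw [h1]
  refine setLIntegral_congr_fun (measurableSet_posDef_smul_one_sub D) fun q hq => ?_
  have hq' : (q.1 • (1 : Matrix (Fin m) (Fin m) ℝ) - D).PosDef := hq
  have n1 : 0 ≤ q.2 ⬝ᵥ q.2 := by simpa using dotProduct_star_self_nonneg q.2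
  have h2 : (LinearMap.toContinuousLinearMap (borderDeriv D q)).det =
      LinearMap.det (borderDeriv D q) := rfl
  simp only [h2]
  rw [det_borderDeriv hD hq', abs_of_nonneg (mul_nonneg hq'.det_pos.le (by positivity))]

end BorderMap

/-! ### An orthogonal matrix with prescribed first column -/

section Frame

variable {m : ℕ}

/-- The inverse of the length of `(1, x)`. -/
noncomputable def invLength (x : Fin m → ℝ) : ℝ := (√(1 + x ⬝ᵥ x))⁻¹

/-- The inverse square root of `1 + x xᵀ`. -/
noncomputable def invSqrtGram (x : Fin m → ℝ) : Matrix (Fin m) (Fin m) ℝ :=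
  1 - (invLength x ^ 2 / (1 + invLength x)) • vecMulVec x x

/-- An orthogonal matrix whose first column is proportional to `(1, x)`. -/
noncomputable def eigenFrame (x : Fin m → ℝ) : Matrix (Fin (m + 1)) (Fin (m + 1)) ℝ :=
  bordered (invLength x) (-invLength x • x) (invLength x • x) (invSqrtGram x)

lemma one_add_dotProduct_self_pos (x : Fin m → ℝ) : 0 < 1 + x ⬝ᵥ x := by
  have : 0 ≤ x ⬝ᵥ x := by simpa using dotProduct_star_self_nonneg x
  positivity

lemma invLength_pos (x : Fin m → ℝ) : 0 < invLength x :=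
  inv_pos.2 (Real.sqrt_pos.2 (one_add_dotProduct_self_pos x))

lemma invLength_sq_mul (x : Fin m → ℝ) : invLength x ^ 2 * (1 + x ⬝ᵥ x) = 1 := by
  rw [invLength, inv_pow, Real.sq_sqrt (one_add_dotProduct_self_pos x).le,
    inv_mul_cancel₀ (one_add_dotProduct_self_pos x).ne']

lemma invSqrtGram_coeff_mul (x : Fin m → ℝ) :
    invLength x ^ 2 / (1 + invLength x) * (x ⬝ᵥ x) = 1 - invLength x := by
  have h1 := invLength_pos x
  have h2 := invLength_sq_mul x
  field_simp
  linarith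

lemma isSymm_invSqrtGram (x : Fin m → ℝ) : (invSqrtGram x).IsSymm := by
  rw [IsSymm, invSqrtGram, transpose_sub, transpose_one, transpose_smul, transpose_vecMulVec]

lemma invSqrtGram_mulVec (x : Fin m → ℝ) : invSqrtGram x *ᵥ x = invLength x • x := by
  rw [invSqrtGram, sub_mulVec, one_mulVec, smul_mulVec, vecMulVec_mulVec]
  ext i
  have h := invSqrtGram_coeff_mul x
  simp only [Pi.sub_apply, Pi.smul_apply, smul_eq_mul, MulOpposite.smul_eq_mul_unop,
    MulOpposite.unop_op]
  linear_combination -(x i) * h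

lemma vecMul_invSqrtGram (x : Fin m → ℝ) : x ᵥ* invSqrtGram x = invLength x • x := by
  rw [← invSqrtGram_mulVec, ← vecMul_transpose, (isSymm_invSqrtGram x).eq]

lemma invSqrtGram_mul_self (x : Fin m → ℝ) :
    invSqrtGram x * invSqrtGram x = 1 - invLength x ^ 2 • vecMulVec x x := by
  nth_rewrite 1 [invSqrtGram]
  rw [sub_mul, one_mul, Matrix.smul_mul, vecMulVec_mul, vecMul_invSqrtGram, invSqrtGram]
  ext i j
  have h1 := invLength_pos x
  simp only [Matrix.sub_apply, Matrix.smul_apply, vecMulVec_apply, Pi.smul_apply, smul_eq_mul]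
  field_simp
  ring

lemma det_invSqrtGram (x : Fin m → ℝ) : (invSqrtGram x).det = invLength x := by
  have h : invSqrtGram x = 1 + replicateCol Unit (-(invLength x ^ 2 / (1 + invLength x)) • x) *
      replicateRow Unit x := by
    rw [invSqrtGram, sub_eq_add_neg, ← neg_smul, ← smul_vecMulVec, vecMulVec_eq Unit]
  rw [h, det_one_add_replicateCol_mul_replicateRow, dotProduct_smul, smul_eq_mul, neg_mul,
    invSqrtGram_coeff_mul]
  ring

lemma eigenFrame_mem (x : Fin m → ℝ) : eigenFrame x ∈ orthogonalGroup (Fin (m + 1)) ℝ := by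
  rw [mem_orthogonalGroup_iff, eigenFrame, transpose_bordered, (isSymm_invSqrtGram x).eq,
    bordered_mul, ← bordered_one]
  have h := invLength_sq_mul x
  congr 1
  · simp only [smul_dotProduct, dotProduct_smul, smul_eq_mul]
    linear_combination h
  · rw [smul_vecMul, vecMul_invSqrtGram]
    simp
  · rw [mulVec_smul, invSqrtGram_mulVec]
    simp
  · rw [invSqrtGram_mul_self]
    ext i j
    simp only [Matrix.add_apply, Matrix.sub_apply, Matrix.smul_apply, vecMulVec_apply,
      Pi.smul_apply, smul_eq_mul]
    ring

lemma continuous_invLength : Continuous (invLength : (Fin m → ℝ) → ℝ) := by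
  unfold invLength
  refine Continuous.inv₀ (by fun_prop) fun x => ?_
  exact (Real.sqrt_pos.2 (one_add_dotProduct_self_pos x)).ne'

lemma continuous_eigenFrame :
    Continuous (eigenFrame : (Fin m → ℝ) → Matrix (Fin (m + 1)) (Fin (m + 1)) ℝ) := by
  have h := continuous_invLength (m := m)
  refine continuous_bordered h (by fun_prop) (by fun_prop) ?_
  have h1 : Continuous fun x : Fin m → ℝ => invLength x ^ 2 / (1 + invLength x) := by
    refine (h.pow 2).div (continuous_const.add h) fun x => ?_
    have := invLength_pos x
    positivity
  have h2 : Continuous fun x : Fin m → ℝ => vecMulVec x x :=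
    continuous_id.matrix_vecMulVec continuous_id
  exact continuous_const.sub (h1.smul h2)

/-- The bordered matrix with row given by `borderMap` is conjugate to a block diagonal one. -/
lemma bordered_borderMap {N : Matrix (Fin m) (Fin m) ℝ} (hN : N.IsSymm) (l : ℝ) (x : Fin m → ℝ) :
    let D := l • (1 : Matrix (Fin m) (Fin m) ℝ) - invSqrtGram x * N * (invSqrtGram x)ᵀ
    bordered (borderMap D (l, x)).1 (borderMap D (l, x)).2 (borderMap D (l, x)).2 D =
      eigenFrame x * bordered l 0 0 (l • (1 : Matrix (Fin m) (Fin m) ℝ) - N) *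
        (eigenFrame x)ᵀ := by
  intro D
  have hA := isSymm_invSqrtGram x
  have h1 : bordered l 0 0 (l • (1 : Matrix (Fin m) (Fin m) ℝ) - N) =
      l • (1 : Matrix (Fin (m + 1)) (Fin (m + 1)) ℝ) - bordered 0 0 0 N := by
    rw [← bordered_one]
    ext i j
    refine Fin.cases ?_ (fun i => ?_) i <;> refine Fin.cases ?_ (fun j => ?_) j <;> simp
  have h2 : eigenFrame x * (eigenFrame x)ᵀ = 1 := by
    exact (mem_orthogonalGroup_iff _ _).1 (eigenFrame_mem x)
  have hMD : l • (1 : Matrix (Fin m) (Fin m) ℝ) - D = invSqrtGram x * N * (invSqrtGram x) := by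
    simp only [D]
    rw [sub_sub_cancel, hA.eq]
  have hMx : (invSqrtGram x * N * (invSqrtGram x)) *ᵥ x =
      invLength x • ((invSqrtGram x) *ᵥ (N *ᵥ x)) := by
    rw [← mulVec_mulVec, invSqrtGram_mulVec, mulVec_smul, ← mulVec_mulVec]
  have hxMx : x ⬝ᵥ (invSqrtGram x) *ᵥ (N *ᵥ x) = invLength x * (x ⬝ᵥ N *ᵥ x) := by
    rw [← hA.mulVec_dotProduct, invSqrtGram_mulVec, smul_dotProduct, smul_eq_mul]
  have hxN : (-invLength x • x) ᵥ* N = -invLength x • (N *ᵥ x) := by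
    rw [smul_vecMul, ← mulVec_transpose, hN.eq]
  have hAN : (N *ᵥ x) ᵥ* invSqrtGram x = invSqrtGram x *ᵥ (N *ᵥ x) := by
    rw [← mulVec_transpose, hA.eq]
  have h3 : eigenFrame x * bordered 0 0 0 N =
      bordered 0 (-invLength x • (N *ᵥ x)) 0 (invSqrtGram x * N) := by
    rw [eigenFrame, bordered_mul, hxN]
    simp
  have h4 : eigenFrame x * bordered 0 0 0 N * (eigenFrame x)ᵀ =
      bordered (invLength x ^ 2 * (x ⬝ᵥ N *ᵥ x))
        (-invLength x • (invSqrtGram x *ᵥ (N *ᵥ x))) (-invLength x • (invSqrtGram x *ᵥ (N *ᵥ x)))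
        (invSqrtGram x * N * invSqrtGram x) := by
    rw [h3, eigenFrame, transpose_bordered, bordered_mul, hA.eq, smul_vecMul, hAN, mulVec_smul,
      ← mulVec_mulVec, smul_dotProduct, dotProduct_smul, dotProduct_comm (N *ᵥ x)]
    simp only [smul_eq_mul, smul_zero, zero_smul, zero_add, zero_mul, zero_vecMulVec]
    congr 1
    ring
  rw [h1, mul_sub, sub_mul, Matrix.mul_smul, mul_one, Matrix.smul_mul, h2, h4]
  simp only [borderMap, hMD, hMx, dotProduct_smul, hxMx, smul_eq_mul]
  ext i j
  refine Fin.cases ?_ (fun i => ?_) i <;> refine Fin.cases ?_ (fun j => ?_) j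
  · simp
    ring
  · simp [(Fin.succ_ne_zero _).symm]
  · simp
  · simp [D, hA.eq, Matrix.one_apply]

end Frame

/-! ### Weights -/

section Weights

/-- The determinant on positive definite matrices, extended by zero. -/
noncomputable def posDefDet {ι : Type*} [Fintype ι] [DecidableEq ι] (M : Matrix ι ι ℝ) : ENNReal :=
  Set.indicator {M : Matrix ι ι ℝ | M.PosDef} (fun M => ENNReal.ofReal M.det) M

/-- The absolute value of the Vandermonde product on decreasing vectors, extended by zero. -/
noncomputable def chamberWeight {n : ℕ} (E : Fin n → ℝ) : ENNReal :=
  Set.indicator {E : Fin n → ℝ | StrictAnti E}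
    (fun E => ENNReal.ofReal (∏ a, ∏ b ∈ Ioi a, |E a - E b|)) E

lemma measurable_posDefDet {ι : Type*} [Fintype ι] [DecidableEq ι] :
    Measurable (posDefDet : Matrix ι ι ℝ → ENNReal) := by
  refine Measurable.indicator ?_ measurableSet_posDef
  exact ENNReal.measurable_ofReal.comp (continuous_id.matrix_det).measurable

lemma posDefDet_conj {ι : Type*} [Fintype ι] [DecidableEq ι] {A : Matrix ι ι ℝ} (hA : A.det ≠ 0)
    (M : Matrix ι ι ℝ) :
    posDefDet (A * M * Aᵀ) = ENNReal.ofReal (A.det ^ 2) * posDefDet M := by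
  by_cases h : M.PosDef
  · have h' : (A * M * Aᵀ).PosDef := (posDef_conj_iff hA).2 h
    rw [posDefDet, posDefDet, Set.indicator_of_mem (by exact h'), Set.indicator_of_mem (by exact h),
      ← ENNReal.ofReal_mul (sq_nonneg _), det_mul, det_mul, det_transpose]
    congr 1
    ring
  · have h' : ¬ (A * M * Aᵀ).PosDef := fun h' => h ((posDef_conj_iff hA).1 h')
    rw [posDefDet, posDefDet, Set.indicator_of_notMem (by exact h'),
      Set.indicator_of_notMem (by exact h), mul_zero]

lemma measurableSet_strictAnti {n : ℕ} : MeasurableSet {E : Fin n → ℝ | StrictAnti E} := by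
  have h : {E : Fin n → ℝ | StrictAnti E} = ⋂ i, ⋂ j, {E | i < j → E j < E i} := by
    ext E
    simp [StrictAnti]
  rw [h]
  refine MeasurableSet.iInter fun i => MeasurableSet.iInter fun j => ?_
  by_cases hij : i < j
  · simpa [hij] using measurableSet_lt (measurable_pi_apply j) (measurable_pi_apply i)
  · simp [hij]

lemma measurable_chamberWeight {n : ℕ} :
    Measurable (chamberWeight : (Fin n → ℝ) → ENNReal) := by
  refine Measurable.indicator (ENNReal.measurable_ofReal.comp ?_) measurableSet_strictAnti
  fun_prop

lemma strictAnti_cons {m : ℕ} (l : ℝ) (E : Fin m → ℝ) :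
    StrictAnti (Fin.cons l E : Fin (m + 1) → ℝ) ↔ (∀ j, E j < l) ∧ StrictAnti E := by
  constructor
  · intro h
    exact ⟨fun j => by simpa using h (Fin.succ_pos j),
      fun i j hij => by simpa using h (Fin.succ_lt_succ_iff.2 hij)⟩
  · rintro ⟨h1, h2⟩ i j
    refine Fin.cases ?_ (fun i => ?_) i <;> refine Fin.cases ?_ (fun j => ?_) j
    · simp
    · simpa using h1 j
    · simp
    · simpa using fun hij => h2 hij

lemma chamberWeight_cons {m : ℕ} (l : ℝ) (E : Fin m → ℝ) :
    chamberWeight (Fin.cons l E : Fin (m + 1) → ℝ) =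
      posDefDet (l • (1 : Matrix (Fin m) (Fin m) ℝ) - diagonal E) * chamberWeight E := by
  have hd : l • (1 : Matrix (Fin m) (Fin m) ℝ) - diagonal E = diagonal fun j => l - E j := by
    rw [← diagonal_one, ← diagonal_smul, diagonal_sub]
    simp
  have hpd : (l • (1 : Matrix (Fin m) (Fin m) ℝ) - diagonal E).PosDef ↔ ∀ j, E j < l := by
    rw [hd, posDef_diagonal_iff]
    simp
  by_cases hE : StrictAnti E
  · by_cases hl : ∀ j, E j < l
    · rw [chamberWeight, chamberWeight, posDefDet,
        Set.indicator_of_mem (by exact (strictAnti_cons l E).2 ⟨hl, hE⟩),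
        Set.indicator_of_mem (by exact hpd.2 hl), Set.indicator_of_mem (by exact hE),
        ← ENNReal.ofReal_mul (hpd.2 hl).det_pos.le, Fin.prod_univ_succ, Fin.prod_Ioi_zero, hd,
        det_diagonal]
      congr 2
      · refine prod_congr rfl fun j _ => ?_
        simpa using (hl j).le
      · refine prod_congr rfl fun j _ => ?_
        rw [Fin.prod_Ioi_succ]
        simp
    · rw [chamberWeight, posDefDet,
        Set.indicator_of_notMem (by exact fun h => hl ((strictAnti_cons l E).1 h).1),
        Set.indicator_of_notMem (by exact fun h => hl (hpd.1 h)), zero_mul]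
  · rw [chamberWeight, chamberWeight,
      Set.indicator_of_notMem (by exact fun h => hE ((strictAnti_cons l E).1 h).2),
      Set.indicator_of_notMem (by exact hE), mul_zero]

end Weights

/-! ### Splitting off the first row -/

section Split

lemma lintegral_prod_prod_comm {α β γ δ : Type*} [MeasureSpace α] [MeasureSpace β]
    [MeasureSpace γ] [MeasureSpace δ] [SFinite (volume : Measure α)]
    [SFinite (volume : Measure β)] [SFinite (volume : Measure γ)] [SFinite (volume : Measure δ)]
    {g : (α × β) × (γ × δ) → ENNReal} (hg : Measurable g) :
    ∫⁻ p, g p = ∫⁻ s : β × δ, ∫⁻ q : α × γ, g ((q.1, s.1), (q.2, s.2)) := by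
  calc ∫⁻ p, g p = ∫⁻ r : α × β, ∫⁻ t : γ × δ, g (r, t) := lintegral_prod _ hg.aemeasurable
    _ = ∫⁻ b, ∫⁻ a, ∫⁻ t : γ × δ, g ((a, b), t) :=
      lintegral_prod_symm _ (Measurable.lintegral_prod_right' hg).aemeasurable
    _ = ∫⁻ b, ∫⁻ a, ∫⁻ d, ∫⁻ c, g ((a, b), (c, d)) := by
      refine lintegral_congr fun b => lintegral_congr fun a => ?_
      exact lintegral_prod_symm _ (by fun_prop)
    _ = ∫⁻ b, ∫⁻ d, ∫⁻ a, ∫⁻ c, g ((a, b), (c, d)) := by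
      refine lintegral_congr fun b => lintegral_lintegral_swap ?_
      refine Measurable.aemeasurable ?_
      exact Measurable.lintegral_prod_right' (f := fun x : (α × δ) × γ =>
        g ((x.1.1, b), (x.2, x.1.2))) (by fun_prop)
    _ = ∫⁻ b, ∫⁻ d, ∫⁻ q : α × γ, g ((q.1, b), (q.2, d)) := by
      refine lintegral_congr fun b => lintegral_congr fun d => ?_
      exact (lintegral_prod (fun q : α × γ => g ((q.1, b), (q.2, d))) (by fun_prop)).symm
    _ = ∫⁻ s : β × δ, ∫⁻ q : α × γ, g ((q.1, s.1), (q.2, s.2)) := by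
      refine (lintegral_prod (fun s : β × δ => ∫⁻ q : α × γ, g ((q.1, s.1), (q.2, s.2))) ?_).symm
      refine Measurable.aemeasurable ?_
      exact Measurable.lintegral_prod_right' (f := fun x : (β × δ) × (α × γ) =>
        g ((x.2.1, x.1.1), (x.2.2, x.1.2))) (by fun_prop)

variable {m : ℕ}

/-- The entries above the diagonal are those in the first row and those in the remaining block. -/
noncomputable def upperIdxEquiv (m : ℕ) : Fin m ⊕ UpperIdx m ≃ UpperIdx (m + 1) :=
  Equiv.ofBijective (Sum.elim (fun j => ⟨(0, j.succ), Fin.succ_pos j⟩)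
    fun u => ⟨(u.1.1.succ, u.1.2.succ), Fin.succ_lt_succ_iff.2 u.2⟩) <| by
  constructor
  · rintro (i | ⟨⟨i, i'⟩, hi⟩) (j | ⟨⟨j, j'⟩, hj⟩) h
    · simpa using h
    · simp [(Fin.succ_ne_zero _).symm] at h
    · simp at h
    · simpa using h
  · rintro ⟨⟨i, j⟩, hij⟩
    refine Fin.cases ?_ (fun j => ?_) j hij
    · exact fun h => (Fin.not_lt_zero _ h).elim
    · refine Fin.cases ?_ (fun i => ?_) i
      · exact fun h => ⟨Sum.inl j, rfl⟩
      · exact fun h => ⟨Sum.inr ⟨(i, j), Fin.succ_lt_succ_iff.1 h⟩, rfl⟩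

/-- Combining the first row with the remaining coordinates. -/
noncomputable def upperJoin (b : Fin m → ℝ) (u : UpperIdx m → ℝ) : UpperIdx (m + 1) → ℝ :=
  fun v => Sum.elim b u ((upperIdxEquiv m).symm v)

lemma upperJoin_upperIdxEquiv (b : Fin m → ℝ) (u : UpperIdx m → ℝ) (w : Fin m ⊕ UpperIdx m) :
    upperJoin b u (upperIdxEquiv m w) = Sum.elim b u w := by
  rw [upperJoin, Equiv.symm_apply_apply]

lemma symOf_cons (a : ℝ) (d b : Fin m → ℝ) (u : UpperIdx m → ℝ) :
    symOf (Fin.cons a d : Fin (m + 1) → ℝ) (upperJoin b u) = bordered a b b (symOf d u) := by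
  have h1 : ∀ j : Fin m, upperJoin b u ⟨(0, j.succ), Fin.succ_pos j⟩ = b j := fun j =>
    upperJoin_upperIdxEquiv b u (Sum.inl j)
  have h2 : ∀ (i j : Fin m) (h : i < j),
      upperJoin b u ⟨(i.succ, j.succ), Fin.succ_lt_succ_iff.2 h⟩ = u ⟨(i, j), h⟩ := fun i j h =>
    upperJoin_upperIdxEquiv b u (Sum.inr ⟨(i, j), h⟩)
  ext i j
  refine Fin.cases ?_ (fun i => ?_) i <;> refine Fin.cases ?_ (fun j => ?_) j
  · simp [symOf]
  · simp [symOf, h1]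
  · simp [symOf, h1]
  · rcases lt_trichotomy i j with h | rfl | h
    · simp [symOf, h, h2]
    · simp [symOf]
    · simp [symOf, h, not_lt_of_gt h, h2]

lemma measurePreserving_upperJoin :
    MeasurePreserving (fun p : (Fin m → ℝ) × (UpperIdx m → ℝ) => upperJoin p.1 p.2) := by
  have h := (volume_measurePreserving_piCongrLeft (fun _ => ℝ) (upperIdxEquiv m)).comp
    (volume_measurePreserving_sumPiEquivProdPi_symm fun _ : Fin m ⊕ UpperIdx m => ℝ)
  have h1 : (fun p : (Fin m → ℝ) × (UpperIdx m → ℝ) => upperJoin p.1 p.2) =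
      MeasurableEquiv.piCongrLeft (fun _ => ℝ) (upperIdxEquiv m) ∘
        (MeasurableEquiv.sumPiEquivProdPi fun _ : Fin m ⊕ UpperIdx m => ℝ).symm := by
    funext p v
    obtain ⟨w, rfl⟩ := (upperIdxEquiv m).surjective v
    rw [upperJoin_upperIdxEquiv, Function.comp_apply, MeasurableEquiv.coe_piCongrLeft,
      Equiv.piCongrLeft_apply_apply]
    rcases w with j | u <;> rfl
  rw [h1]
  exact h

lemma measurePreserving_cons :
    MeasurePreserving (fun p : ℝ × (Fin m → ℝ) => (Fin.cons p.1 p.2 : Fin (m + 1) → ℝ)) := by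
  have h := (volume_preserving_piFinSuccAbove (fun _ : Fin (m + 1) => ℝ) 0).symm
  have h1 : (fun p : ℝ × (Fin m → ℝ) => (Fin.cons p.1 p.2 : Fin (m + 1) → ℝ)) =
      (MeasurableEquiv.piFinSuccAbove (fun _ : Fin (m + 1) => ℝ) 0).symm := by
    funext p
    exact (Fin.insertNth_zero' p.1 p.2).symm
  rw [h1]
  exact h

lemma lintegral_symOf_succ {h : Matrix (Fin (m + 1)) (Fin (m + 1)) ℝ → ENNReal}
    (hh : Measurable h) :
    ∫⁻ p : (Fin (m + 1) → ℝ) × (UpperIdx (m + 1) → ℝ), h (symOf p.1 p.2) =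
      ∫⁻ s : (Fin m → ℝ) × (UpperIdx m → ℝ), ∫⁻ q : ℝ × (Fin m → ℝ),
        h (bordered q.1 q.2 q.2 (symOf s.1 s.2)) := by
  have h1 := (measurePreserving_cons (m := m)).prod (measurePreserving_upperJoin (m := m))
  have h2 : Measurable fun p : (Fin (m + 1) → ℝ) × (UpperIdx (m + 1) → ℝ) => h (symOf p.1 p.2) :=
    hh.comp continuous_symOf.measurable
  calc _ = ∫⁻ p : (ℝ × (Fin m → ℝ)) × ((Fin m → ℝ) × (UpperIdx m → ℝ)),
        h (symOf (Fin.cons p.1.1 p.1.2 : Fin (m + 1) → ℝ) (upperJoin p.2.1 p.2.2)) :=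
      (h1.lintegral_comp h2).symm
    _ = _ := by
      refine (lintegral_prod_prod_comm (h2.comp h1.measurable)).trans ?_
      simp only [Function.comp_def, Prod.map, symOf_cons]

end Split

/-! ### The normalization integral -/

section Cauchy

lemma lintegral_Ioi_rpow_mul_exp_neg_mul {s r : ℝ} (hs : 0 < s) (hr : 0 < r) :
    ∫⁻ t in Set.Ioi (0 : ℝ), ENNReal.ofReal (t ^ (s - 1) * Real.exp (-(r * t))) =
      ENNReal.ofReal ((1 / r) ^ s * Real.Gamma s) := by
  have h := Real.integral_rpow_mul_exp_neg_mul_Ioi hs hr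
  have hpos : 0 < (1 / r) ^ s * Real.Gamma s := by
    have := Real.Gamma_pos_of_pos hs
    positivity
  have hi : IntegrableOn (fun t : ℝ => t ^ (s - 1) * Real.exp (-(r * t))) (Set.Ioi 0) :=
    Integrable.of_integral_ne_zero (by rw [h]; exact hpos.ne')
  rw [← h, ofReal_integral_eq_lintegral_ofReal hi]
  filter_upwards [ae_restrict_mem measurableSet_Ioi] with t ht
  have : (0 : ℝ) < t := ht
  simp only [Pi.zero_apply]
  positivity

lemma lintegral_exp_neg_mul_dotProduct_self (m : ℕ) {t : ℝ} (ht : 0 < t) :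
    ∫⁻ x : Fin m → ℝ, ENNReal.ofReal (Real.exp (-(t * (x ⬝ᵥ x)))) =
      ENNReal.ofReal ((Real.pi / t) ^ ((m : ℝ) / 2)) := by
  have h1 : ∀ x : Fin m → ℝ, Real.exp (-(t * (x ⬝ᵥ x))) = ∏ i, Real.exp (-t * x i ^ 2) := by
    intro x
    rw [← Real.exp_sum, ← mul_sum, neg_mul]
    simp [dotProduct, sq]
  have hi : Integrable fun x : Fin m → ℝ => ∏ i, Real.exp (-t * x i ^ 2) :=
    Integrable.fintype_prod fun _ => integrable_exp_neg_mul_sq ht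
  simp only [h1]
  rw [← ofReal_integral_eq_lintegral_ofReal hi (Filter.Eventually.of_forall fun x => by
    simp only [Pi.zero_apply]
    positivity), integral_fintype_prod_volume_eq_pow (fun y : ℝ => Real.exp (-t * y ^ 2)),
    integral_gaussian, Fintype.card_fin, Real.sqrt_eq_rpow, ← Real.rpow_natCast,
    ← Real.rpow_mul (by positivity)]
  congr 2
  ring

lemma lintegral_invLength_pow (m : ℕ) :
    ∫⁻ x : Fin m → ℝ, ENNReal.ofReal (invLength x ^ (m + 1)) =
      ENNReal.ofReal (Real.pi ^ ((m : ℝ) / 2) * Real.Gamma (1 / 2) /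
        Real.Gamma (((m : ℝ) + 1) / 2)) := by
  have hs : (0 : ℝ) < ((m : ℝ) + 1) / 2 := by positivity
  have hG := Real.Gamma_pos_of_pos hs
  have hG2 := Real.Gamma_pos_of_pos (one_half_pos (α := ℝ))
  have h1 : ∀ x : Fin m → ℝ, ENNReal.ofReal (Real.Gamma (((m : ℝ) + 1) / 2)) *
      ENNReal.ofReal (invLength x ^ (m + 1)) = ∫⁻ t in Set.Ioi (0 : ℝ),
        ENNReal.ofReal (t ^ (((m : ℝ) + 1) / 2 - 1) * Real.exp (-((1 + x ⬝ᵥ x) * t))) := by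
    intro x
    have hx := one_add_dotProduct_self_pos x
    rw [lintegral_Ioi_rpow_mul_exp_neg_mul hs hx, ← ENNReal.ofReal_mul hG.le, mul_comm, invLength,
      Real.sqrt_eq_rpow, one_div (1 + x ⬝ᵥ x), Real.inv_rpow hx.le, ← Real.rpow_neg hx.le,
      ← Real.rpow_natCast, ← Real.rpow_mul hx.le, ← Real.rpow_neg hx.le]
    congr 3
    push_cast
    ring
  have h2 : ∀ t ∈ Set.Ioi (0 : ℝ), (∫⁻ x : Fin m → ℝ,
      ENNReal.ofReal (t ^ (((m : ℝ) + 1) / 2 - 1) * Real.exp (-((1 + x ⬝ᵥ x) * t)))) =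
      ENNReal.ofReal (Real.pi ^ ((m : ℝ) / 2)) *
        ENNReal.ofReal (t ^ ((1 / 2 : ℝ) - 1) * Real.exp (-(1 * t))) := by
    intro t ht
    have ht : (0 : ℝ) < t := ht
    have h3 : ∀ x : Fin m → ℝ,
        ENNReal.ofReal (t ^ (((m : ℝ) + 1) / 2 - 1) * Real.exp (-((1 + x ⬝ᵥ x) * t))) =
        ENNReal.ofReal (t ^ (((m : ℝ) + 1) / 2 - 1) * Real.exp (-(1 * t))) *
          ENNReal.ofReal (Real.exp (-(t * (x ⬝ᵥ x)))) := by
      intro x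
      rw [← ENNReal.ofReal_mul (by positivity), mul_assoc, ← Real.exp_add]
      congr 3
      ring
    simp only [h3]
    rw [lintegral_const_mul' _ _ ENNReal.ofReal_ne_top, lintegral_exp_neg_mul_dotProduct_self m ht,
      ← ENNReal.ofReal_mul (by positivity), ← ENNReal.ofReal_mul (by positivity),
      Real.div_rpow Real.pi_pos.le ht.le]
    congr 1
    have h4 : t ^ (((m : ℝ) + 1) / 2 - 1) = t ^ ((1 / 2 : ℝ) - 1) * t ^ ((m : ℝ) / 2) := by
      rw [← Real.rpow_add ht]
      congr 1
      ring
    have h5 : t ^ ((m : ℝ) / 2) ≠ 0 := (Real.rpow_pos_of_pos ht _).ne'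
    rw [h4]
    field_simp
  have h6 : ENNReal.ofReal (Real.Gamma (((m : ℝ) + 1) / 2)) *
      ∫⁻ x : Fin m → ℝ, ENNReal.ofReal (invLength x ^ (m + 1)) =
      ENNReal.ofReal (Real.pi ^ ((m : ℝ) / 2) * Real.Gamma (1 / 2)) := by
    rw [← lintegral_const_mul' _ _ ENNReal.ofReal_ne_top]
    simp only [h1]
    rw [lintegral_lintegral_swap, setLIntegral_congr_fun measurableSet_Ioi h2,
      lintegral_const_mul' _ _ ENNReal.ofReal_ne_top,
      lintegral_Ioi_rpow_mul_exp_neg_mul one_half_pos one_pos,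
      ← ENNReal.ofReal_mul (by positivity)]
    · simp
    · simp only [dotProduct]
      fun_prop
  rw [ENNReal.ofReal_div_of_pos hG, ← h6, mul_comm, ENNReal.mul_div_cancel_right
    (ENNReal.ofReal_pos.2 hG).ne' ENNReal.ofReal_ne_top]

end Cauchy

/-! ### Diagonalization of the flat measure -/

section Diagonalization

variable {m : ℕ}

lemma lintegral_symOf_borderMap {h : Matrix (Fin (m + 1)) (Fin (m + 1)) ℝ → ENNReal}
    (hh : Measurable h) (l : ℝ) (x : Fin m → ℝ) :
    ∫⁻ s : (Fin m → ℝ) × (UpperIdx m → ℝ),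
      posDefDet (l • (1 : Matrix (Fin m) (Fin m) ℝ) - symOf s.1 s.2) *
        ENNReal.ofReal (1 + x ⬝ᵥ x) *
        h (bordered (borderMap (symOf s.1 s.2) (l, x)).1 (borderMap (symOf s.1 s.2) (l, x)).2
          (borderMap (symOf s.1 s.2) (l, x)).2 (symOf s.1 s.2)) =
    ENNReal.ofReal (invLength x ^ (m + 1)) * ∫⁻ s : (Fin m → ℝ) × (UpperIdx m → ℝ),
      posDefDet (l • (1 : Matrix (Fin m) (Fin m) ℝ) - symOf s.1 s.2) *
        h (eigenFrame x * bordered l 0 0 (symOf s.1 s.2) * (eigenFrame x)ᵀ) := by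
  have hA := isSymm_invSqrtGram x
  have hdet : (invSqrtGram x).det ≠ 0 := by
    rw [det_invSqrtGram]
    exact (invLength_pos x).ne'
  have hB : Continuous fun M : Matrix (Fin m) (Fin m) ℝ =>
      bordered (borderMap M (l, x)).1 (borderMap M (l, x)).2 (borderMap M (l, x)).2 M := by
    unfold borderMap
    exact continuous_bordered (by fun_prop) (by fun_prop) (by fun_prop) continuous_id
  have hS : Measurable fun M : Matrix (Fin m) (Fin m) ℝ =>
      l • (1 : Matrix (Fin m) (Fin m) ℝ) - M :=
    Continuous.measurable (by fun_prop)
  let F : Matrix (Fin m) (Fin m) ℝ → ENNReal := fun M =>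
    posDefDet (l • (1 : Matrix (Fin m) (Fin m) ℝ) - M) * ENNReal.ofReal (1 + x ⬝ᵥ x) *
      h (bordered (borderMap M (l, x)).1 (borderMap M (l, x)).2 (borderMap M (l, x)).2 M)
  let K : Matrix (Fin m) (Fin m) ℝ → ENNReal := fun M =>
    posDefDet (l • (1 : Matrix (Fin m) (Fin m) ℝ) - M) *
      h (eigenFrame x * bordered l 0 0 M * (eigenFrame x)ᵀ)
  have hF : Measurable F :=
    ((measurable_posDefDet.comp hS).mul_const _).mul (hh.comp hB.measurable)
  have hFK : ∀ N : Matrix (Fin m) (Fin m) ℝ, N.IsSymm →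
      F (l • (1 : Matrix (Fin m) (Fin m) ℝ) - invSqrtGram x * N * (invSqrtGram x)ᵀ) =
        K (l • (1 : Matrix (Fin m) (Fin m) ℝ) - N) := by
    intro N hN
    have h1 : ENNReal.ofReal (invLength x ^ 2) * ENNReal.ofReal (1 + x ⬝ᵥ x) = 1 := by
      rw [← ENNReal.ofReal_mul (sq_nonneg _), invLength_sq_mul, ENNReal.ofReal_one]
    simp only [F, K]
    rw [bordered_borderMap hN, sub_sub_cancel, sub_sub_cancel, posDefDet_conj hdet,
      det_invSqrtGram, mul_comm (ENNReal.ofReal _) (posDefDet N), mul_assoc (posDefDet N), h1,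
      mul_one]
  change ∫⁻ s : (Fin m → ℝ) × (UpperIdx m → ℝ), F (symOf s.1 s.2) =
    _ * ∫⁻ s : (Fin m → ℝ) × (UpperIdx m → ℝ), K (symOf s.1 s.2)
  rw [← lintegral_symOf_const_sub l F, lintegral_symOf_conj hA hdet
    (h := fun M => F (l • (1 : Matrix (Fin m) (Fin m) ℝ) - M)) (hF.comp hS),
    ← lintegral_symOf_const_sub l K, det_invSqrtGram, abs_of_pos (invLength_pos x)]
  simp only [hFK _ (isSymm_symOf _ _)]

lemma lintegral_symOf_eq_frame {h : Matrix (Fin (m + 1)) (Fin (m + 1)) ℝ → ENNReal}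
    (hh : Measurable h) :
    ∫⁻ p : (Fin (m + 1) → ℝ) × (UpperIdx (m + 1) → ℝ), h (symOf p.1 p.2) =
      ∫⁻ x : Fin m → ℝ, ENNReal.ofReal (invLength x ^ (m + 1)) *
        ∫⁻ l : ℝ, ∫⁻ s : (Fin m → ℝ) × (UpperIdx m → ℝ),
          posDefDet (l • (1 : Matrix (Fin m) (Fin m) ℝ) - symOf s.1 s.2) *
            h (eigenFrame x * bordered l 0 0 (symOf s.1 s.2) * (eigenFrame x)ᵀ) := by
  let G : (ℝ × (Fin m → ℝ)) → Matrix (Fin m) (Fin m) ℝ → ENNReal := fun q M =>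
    posDefDet (q.1 • (1 : Matrix (Fin m) (Fin m) ℝ) - M) * ENNReal.ofReal (1 + q.2 ⬝ᵥ q.2) *
      h (bordered (borderMap M q).1 (borderMap M q).2 (borderMap M q).2 M)
  have hs : Continuous fun z : ((Fin m → ℝ) × (UpperIdx m → ℝ)) × (ℝ × (Fin m → ℝ)) =>
      symOf z.1.1 z.1.2 := continuous_symOf.comp continuous_fst
  have hG : Measurable fun z : ((Fin m → ℝ) × (UpperIdx m → ℝ)) × (ℝ × (Fin m → ℝ)) =>
      G z.2 (symOf z.1.1 z.1.2) := by
    have h1 : Continuous fun z : ((Fin m → ℝ) × (UpperIdx m → ℝ)) × (ℝ × (Fin m → ℝ)) =>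
        z.2.1 • (1 : Matrix (Fin m) (Fin m) ℝ) - symOf z.1.1 z.1.2 := by
      fun_prop
    have h2 : Continuous fun z : ((Fin m → ℝ) × (UpperIdx m → ℝ)) × (ℝ × (Fin m → ℝ)) =>
        borderMap (symOf z.1.1 z.1.2) z.2 := by
      unfold borderMap
      fun_prop
    have h3 : Continuous fun z : ((Fin m → ℝ) × (UpperIdx m → ℝ)) × (ℝ × (Fin m → ℝ)) =>
        1 + z.2.2 ⬝ᵥ z.2.2 := by
      fun_prop
    exact ((measurable_posDefDet.comp h1.measurable).mul h3.measurable.ennreal_ofReal).mul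
      (hh.comp (continuous_bordered h2.fst h2.snd h2.snd hs).measurable)
  calc _ = ∫⁻ s : (Fin m → ℝ) × (UpperIdx m → ℝ), ∫⁻ q : ℝ × (Fin m → ℝ),
        h (bordered q.1 q.2 q.2 (symOf s.1 s.2)) := lintegral_symOf_succ hh
    _ = ∫⁻ s : (Fin m → ℝ) × (UpperIdx m → ℝ), ∫⁻ q : ℝ × (Fin m → ℝ),
        G q (symOf s.1 s.2) := by
      refine lintegral_congr fun s => ?_
      rw [lintegral_borderMap (isSymm_symOf s.1 s.2), ← lintegral_indicator
        (measurableSet_posDef_smul_one_sub _)]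
      refine lintegral_congr fun q => ?_
      by_cases hq : (q.1 • (1 : Matrix (Fin m) (Fin m) ℝ) - symOf s.1 s.2).PosDef
      · rw [Set.indicator_of_mem (by exact hq), ENNReal.ofReal_mul hq.det_pos.le]
        simp only [G, posDefDet]
        rw [Set.indicator_of_mem (by exact hq)]
      · rw [Set.indicator_of_notMem (by exact hq)]
        simp only [G, posDefDet]
        rw [Set.indicator_of_notMem (by exact hq), zero_mul, zero_mul]
    _ = ∫⁻ q : ℝ × (Fin m → ℝ), ∫⁻ s : (Fin m → ℝ) × (UpperIdx m → ℝ), G q (symOf s.1 s.2) :=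
      lintegral_lintegral_swap hG.aemeasurable
    _ = ∫⁻ x : Fin m → ℝ, ∫⁻ l : ℝ, ∫⁻ s : (Fin m → ℝ) × (UpperIdx m → ℝ),
        G (l, x) (symOf s.1 s.2) :=
      lintegral_prod_symm _ (Measurable.lintegral_prod_left' hG).aemeasurable
    _ = _ := by
      refine lintegral_congr fun x => ?_
      rw [← lintegral_const_mul' _ _ ENNReal.ofReal_ne_top]
      exact lintegral_congr fun l => lintegral_symOf_borderMap hh l x

/-- The volume of the manifold of ordered orthonormal eigenframes up to signs. -/
noncomputable def frameVolume (n : ℕ) : ℝ :=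
  ∏ j ∈ Icc 1 n,
    Real.pi ^ (((j : ℝ) - 1) / 2) * Real.Gamma (1 / 2) / Real.Gamma ((j : ℝ) / 2)

lemma frameVolume_succ (n : ℕ) :
    frameVolume (n + 1) = Real.pi ^ ((n : ℝ) / 2) * Real.Gamma (1 / 2) /
        Real.Gamma (((n : ℝ) + 1) / 2) * frameVolume n := by
  rw [frameVolume, prod_Icc_succ_top (Nat.le_add_left 1 n), mul_comm, frameVolume]
  simp

lemma bordered_one_mul_conj (l : ℝ) (O M : Matrix (Fin m) (Fin m) ℝ) :
    bordered l 0 0 (O * M * Oᵀ) = bordered 1 0 0 O * bordered l 0 0 M * (bordered 1 0 0 O)ᵀ := by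
  rw [transpose_bordered, bordered_mul, bordered_mul]
  simp

lemma bordered_one_mem {O : Matrix (Fin m) (Fin m) ℝ} (hO : O ∈ orthogonalGroup (Fin m) ℝ) :
    bordered 1 0 0 O ∈ orthogonalGroup (Fin (m + 1)) ℝ := by
  rw [mem_orthogonalGroup_iff] at hO ⊢
  rw [transpose_bordered, bordered_mul, hO]
  simp [bordered_one]

lemma posDefDet_smul_one_sub_conj {O : Matrix (Fin m) (Fin m) ℝ}
    (hO : O ∈ orthogonalGroup (Fin m) ℝ) (l : ℝ) (M : Matrix (Fin m) (Fin m) ℝ) :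
    posDefDet (l • (1 : Matrix (Fin m) (Fin m) ℝ) - O * M * Oᵀ) =
      posDefDet (l • (1 : Matrix (Fin m) (Fin m) ℝ) - M) := by
  rw [mem_orthogonalGroup_iff] at hO
  have h1 : l • (1 : Matrix (Fin m) (Fin m) ℝ) - O * M * Oᵀ =
      O * (l • (1 : Matrix (Fin m) (Fin m) ℝ) - M) * Oᵀ := by
    rw [mul_sub, sub_mul, Matrix.mul_smul, mul_one, Matrix.smul_mul, hO]
  have h2 : O.det ^ 2 = 1 := by
    rw [sq, ← det_one (n := Fin m) (R := ℝ), ← hO, det_mul, det_transpose]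
  rw [h1, posDefDet_conj (by rintro h; simp [h] at h2), h2]
  simp

lemma measurable_conj_diagonal {n : ℕ} {Ω : Type*} [MeasurableSpace Ω]
    {O : Ω → Matrix (Fin n) (Fin n) ℝ} (hO : Measurable O) :
    Measurable fun z : Ω × (Fin n → ℝ) => O z.1 * diagonal z.2 * (O z.1)ᵀ := by
  have hc : Continuous fun w : Matrix (Fin n) (Fin n) ℝ × (Fin n → ℝ) =>
      w.1 * diagonal w.2 * w.1ᵀ := by
    fun_prop
  exact hc.measurable.comp ((hO.comp measurable_fst).prodMk measurable_snd)

lemma measurable_bordered_one {Ω : Type*} [MeasurableSpace Ω]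
    {Q : Ω → Matrix (Fin (m + 1)) (Fin (m + 1)) ℝ} {O : Ω → Matrix (Fin m) (Fin m) ℝ}
    (hQ : Measurable Q) (hO : Measurable O) : Measurable fun z => Q z * bordered 1 0 0 (O z) := by
  have hc : Continuous fun w : Matrix (Fin (m + 1)) (Fin (m + 1)) ℝ × Matrix (Fin m) (Fin m) ℝ =>
      w.1 * bordered 1 0 0 w.2 :=
    continuous_fst.mul
      (continuous_bordered continuous_const continuous_const continuous_const continuous_snd)
  exact hc.measurable.comp (hQ.prodMk hO)

lemma lintegral_bordered_symOf {Ω : Type*} [MeasurableSpace Ω] {ρ : Measure Ω} [SFinite ρ]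
    {O : Ω → Matrix (Fin m) (Fin m) ℝ} (hO : Measurable O)
    (hmem : ∀ ω, O ω ∈ orthogonalGroup (Fin m) ℝ)
    (hint : ∀ h : Matrix (Fin m) (Fin m) ℝ → ENNReal, Measurable h →
      ∫⁻ p : (Fin m → ℝ) × (UpperIdx m → ℝ), h (symOf p.1 p.2) =
        ∫⁻ ω, (∫⁻ E : Fin m → ℝ, chamberWeight E * h (O ω * diagonal E * (O ω)ᵀ)) ∂ρ)
    {h : Matrix (Fin (m + 1)) (Fin (m + 1)) ℝ → ENNReal} (hh : Measurable h)
    (Q : Matrix (Fin (m + 1)) (Fin (m + 1)) ℝ) :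
    ∫⁻ l : ℝ, ∫⁻ s : (Fin m → ℝ) × (UpperIdx m → ℝ),
      posDefDet (l • (1 : Matrix (Fin m) (Fin m) ℝ) - symOf s.1 s.2) *
        h (Q * bordered l 0 0 (symOf s.1 s.2) * Qᵀ) =
    ∫⁻ ω, (∫⁻ E : Fin (m + 1) → ℝ, chamberWeight E *
      h (Q * bordered 1 0 0 (O ω) * diagonal E * (Q * bordered 1 0 0 (O ω))ᵀ)) ∂ρ := by
  obtain ⟨J, hJdef⟩ : ∃ J : Ω → (Fin (m + 1) → ℝ) → ENNReal, ∀ ω E, J ω E = chamberWeight E *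
      h (Q * bordered 1 0 0 (O ω) * diagonal E * (Q * bordered 1 0 0 (O ω))ᵀ) :=
    ⟨_, fun _ _ => rfl⟩
  have hJ : Measurable fun z : Ω × (Fin (m + 1) → ℝ) => J z.1 z.2 := by
    have h1 : Measurable fun z : Ω × (Fin (m + 1) → ℝ) =>
        Q * bordered 1 0 0 (O z.1) * diagonal z.2 * (Q * bordered 1 0 0 (O z.1))ᵀ :=
      measurable_conj_diagonal (O := fun ω => Q * bordered 1 0 0 (O ω))
        (measurable_bordered_one measurable_const hO)
    simp only [hJdef]
    exact (measurable_chamberWeight.comp measurable_snd).mul (hh.comp h1)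
  have hcons : Measurable fun z : ℝ × (Fin m → ℝ) =>
      (Fin.cons z.1 z.2 : Fin (m + 1) → ℝ) := measurePreserving_cons.measurable
  have hl : ∀ l : ℝ, ∫⁻ s : (Fin m → ℝ) × (UpperIdx m → ℝ),
      posDefDet (l • (1 : Matrix (Fin m) (Fin m) ℝ) - symOf s.1 s.2) *
        h (Q * bordered l 0 0 (symOf s.1 s.2) * Qᵀ) =
      ∫⁻ ω, (∫⁻ E : Fin m → ℝ, J ω (Fin.cons l E)) ∂ρ := by
    intro l
    have h1 : Continuous fun M : Matrix (Fin m) (Fin m) ℝ =>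
        l • (1 : Matrix (Fin m) (Fin m) ℝ) - M := by
      fun_prop
    have h2 : Continuous fun M : Matrix (Fin m) (Fin m) ℝ => Q * bordered l 0 0 M * Qᵀ :=
      (continuous_const.mul (continuous_bordered continuous_const continuous_const
        continuous_const continuous_id)).mul continuous_const
    rw [hint (fun M => posDefDet (l • (1 : Matrix (Fin m) (Fin m) ℝ) - M) *
        h (Q * bordered l 0 0 M * Qᵀ))
      ((measurable_posDefDet.comp h1.measurable).mul (hh.comp h2.measurable))]
    refine lintegral_congr fun ω => lintegral_congr fun E => ?_
    rw [hJdef, posDefDet_smul_one_sub_conj (hmem ω), chamberWeight_cons, bordered_one_mul_conj,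
      bordered_diagonal, transpose_mul]
    simp only [← mul_assoc]
    rw [mul_comm (chamberWeight E)]
  simp only [hl, ← hJdef]
  rw [lintegral_lintegral_swap]
  · refine lintegral_congr fun ω => ?_
    have hω : Measurable (J ω) := hJ.comp measurable_prodMk_left
    rw [← (measurePreserving_cons (m := m)).lintegral_comp hω]
    exact (lintegral_prod (fun z : ℝ × (Fin m → ℝ) => J ω (Fin.cons z.1 z.2))
      (hω.comp hcons).aemeasurable).symm
  · refine Measurable.aemeasurable ?_
    exact Measurable.lintegral_prod_right' (f := fun z : (ℝ × Ω) × (Fin m → ℝ) =>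
      J z.1.2 (Fin.cons z.1.1 z.2)) (hJ.comp ((measurable_snd.comp measurable_fst).prodMk
        (hcons.comp ((measurable_fst.comp measurable_fst).prodMk measurable_snd))))

/-- The flat measure on symmetric matrices is an integral over ordered eigenvalues and
orthogonal eigenframes. -/
theorem exists_diagonalization (n : ℕ) :
    ∃ (Ω : Type) (_ : MeasurableSpace Ω) (ρ : Measure Ω) (O : Ω → Matrix (Fin n) (Fin n) ℝ),
      ρ Set.univ = ENNReal.ofReal (frameVolume n) ∧ Measurable O ∧
      (∀ ω, O ω ∈ orthogonalGroup (Fin n) ℝ) ∧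
      ∀ h : Matrix (Fin n) (Fin n) ℝ → ENNReal, Measurable h →
        ∫⁻ p : (Fin n → ℝ) × (UpperIdx n → ℝ), h (symOf p.1 p.2) =
          ∫⁻ ω, (∫⁻ E : Fin n → ℝ, chamberWeight E * h (O ω * diagonal E * (O ω)ᵀ)) ∂ρ := by
  induction n with
  | zero =>
    refine ⟨Unit, inferInstance, Measure.dirac (), fun _ => 1, ?_, measurable_const,
      fun _ => one_mem _, fun h hh => ?_⟩
    · simp [frameVolume]
    · have h1 : ∀ M : Matrix (Fin 0) (Fin 0) ℝ, h M = h 1 := fun M =>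
        congrArg h (Subsingleton.elim _ _)
      have h2 : ∀ E : Fin 0 → ℝ, chamberWeight E = 1 := fun E => by
        rw [chamberWeight, Set.indicator_of_mem (by exact fun i => i.elim0)]
        simp
      simp only [h1, h2, lintegral_const]
      rw [Measure.volume_eq_prod, ← Set.univ_prod_univ, Measure.prod_prod]
      simp [volume_pi]
  | succ m ih =>
    obtain ⟨Ω, mΩ, ρ, O, hρ, hO, hmem, hint⟩ := ih
    have : IsFiniteMeasure ρ := ⟨by rw [hρ]; exact ENNReal.ofReal_lt_top⟩
    have hd : Measurable fun x : Fin m → ℝ => ENNReal.ofReal (invLength x ^ (m + 1)) :=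
      (continuous_invLength.pow _).measurable.ennreal_ofReal
    have hO' : Measurable fun z : (Fin m → ℝ) × Ω => eigenFrame z.1 * bordered 1 0 0 (O z.2) :=
      measurable_bordered_one (continuous_eigenFrame.measurable.comp measurable_fst)
        (hO.comp measurable_snd)
    refine ⟨(Fin m → ℝ) × Ω, inferInstance,
      (volume.withDensity fun x => ENNReal.ofReal (invLength x ^ (m + 1))).prod ρ,
      fun z => eigenFrame z.1 * bordered 1 0 0 (O z.2), ?_, hO',
      fun z => mul_mem (eigenFrame_mem _) (bordered_one_mem (hmem _)), fun h hh => ?_⟩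
    · rw [← Set.univ_prod_univ, Measure.prod_prod, hρ, withDensity_apply _ MeasurableSet.univ,
        Measure.restrict_univ, lintegral_invLength_pow, frameVolume_succ, ← ENNReal.ofReal_mul]
      have h1 : (0 : ℝ) < ((m : ℝ) + 1) / 2 := by positivity
      have h2 := Real.Gamma_pos_of_pos h1
      have h3 := Real.Gamma_pos_of_pos (one_half_pos (α := ℝ))
      positivity
    · obtain ⟨J, hJdef⟩ : ∃ J : (Fin m → ℝ) × Ω → ENNReal, ∀ z, J z =
          ∫⁻ E : Fin (m + 1) → ℝ, chamberWeight E *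
            h (eigenFrame z.1 * bordered 1 0 0 (O z.2) * diagonal E *
              (eigenFrame z.1 * bordered 1 0 0 (O z.2))ᵀ) := ⟨_, fun _ => rfl⟩
      have hJ : Measurable J := by
        have h1 : Measurable fun z : ((Fin m → ℝ) × Ω) × (Fin (m + 1) → ℝ) =>
            eigenFrame z.1.1 * bordered 1 0 0 (O z.1.2) * diagonal z.2 *
              (eigenFrame z.1.1 * bordered 1 0 0 (O z.1.2))ᵀ :=
          measurable_conj_diagonal (O := fun z : (Fin m → ℝ) × Ω =>
            eigenFrame z.1 * bordered 1 0 0 (O z.2)) hO'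
        rw [funext hJdef]
        exact ((measurable_chamberWeight.comp measurable_snd).mul
          (hh.comp h1)).lintegral_prod_right'
      rw [lintegral_symOf_eq_frame hh]
      simp only [← hJdef]
      rw [lintegral_prod _ hJ.aemeasurable,
        lintegral_withDensity_eq_lintegral_mul _ hd hJ.lintegral_prod_right']
      refine lintegral_congr fun x => ?_
      rw [lintegral_bordered_symOf hO hmem hint hh, Pi.mul_apply]
      simp only [hJdef]

end Diagonalization

/-! ### Passing to unordered eigenvalues -/

section Weyl

variable {n : ℕ}

lemma frameVolume_pos (n : ℕ) : 0 < frameVolume n := by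
  refine prod_pos fun j hj => ?_
  have h1 : (0 : ℝ) < j := by exact_mod_cast (mem_Icc.1 hj).1
  have h2 := Real.Gamma_pos_of_pos (half_pos h1)
  have h3 := Real.Gamma_pos_of_pos (one_half_pos (α := ℝ))
  positivity

/-- The flat measure on symmetric matrices as the image of a product measure. -/
lemma exists_map_eq_volume (n : ℕ) :
    ∃ (Ω : Type) (_ : MeasurableSpace Ω) (ρ : Measure Ω) (O : Ω → Matrix (Fin n) (Fin n) ℝ),
      ρ Set.univ = ENNReal.ofReal (frameVolume n) ∧
      (∀ ω, O ω ∈ orthogonalGroup (Fin n) ℝ) ∧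
      (Measurable fun z : Ω × (Fin n → ℝ) => symCoords (O z.1 * diagonal z.2 * (O z.1)ᵀ)) ∧
      (ρ.prod (volume.withDensity chamberWeight)).map
        (fun z : Ω × (Fin n → ℝ) => symCoords (O z.1 * diagonal z.2 * (O z.1)ᵀ)) = volume := by
  obtain ⟨Ω, mΩ, ρ, O, hρ, hO, hmem, hint⟩ := exists_diagonalization n
  have hT : Measurable fun z : Ω × (Fin n → ℝ) =>
      symCoords (O z.1 * diagonal z.2 * (O z.1)ᵀ) :=
    continuous_symCoords.measurable.comp (measurable_conj_diagonal hO)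
  refine ⟨Ω, mΩ, ρ, O, hρ, hmem, hT, Measure.ext_of_lintegral _ fun k hk => ?_⟩
  have h1 := hint (fun M => k (symCoords M)) (hk.comp continuous_symCoords.measurable)
  simp only [symCoords_symOf] at h1
  rw [lintegral_map hk hT, h1]
  refine (lintegral_prod _ (hk.comp hT).aemeasurable).trans ?_
  refine lintegral_congr fun ω => ?_
  exact lintegral_withDensity_eq_lintegral_mul _ measurable_chamberWeight
    ((hk.comp hT).comp measurable_prodMk_left)

lemma integral_symOf_eq_chamber {f : Matrix (Fin n) (Fin n) ℝ → ℂ}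
    (hinv : ∀ H : Matrix (Fin n) (Fin n) ℝ, H.IsSymm →
      ∀ O ∈ Matrix.orthogonalGroup (Fin n) ℝ, f (O * H * Oᵀ) = f H)
    (hint : Integrable (fun p : (Fin n → ℝ) × (UpperIdx n → ℝ) => f (symOf p.1 p.2))) :
    Integrable (fun E => f (diagonal E)) (volume.withDensity chamberWeight) ∧
    ∫ p : (Fin n → ℝ) × (UpperIdx n → ℝ), f (symOf p.1 p.2) =
      frameVolume n * ∫ E, f (diagonal E) ∂volume.withDensity chamberWeight := by
  obtain ⟨Ω, mΩ, ρ, O, hρ, hmem, hT, hmap⟩ := exists_map_eq_volume n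
  have : IsFiniteMeasure ρ := ⟨by rw [hρ]; exact ENNReal.ofReal_lt_top⟩
  have : NeZero ρ := ⟨fun h => by
    rw [h] at hρ
    exact (ENNReal.ofReal_pos.2 (frameVolume_pos n)).ne hρ⟩
  have hf : ∀ z : Ω × (Fin n → ℝ), f (symOf (symCoords (O z.1 * diagonal z.2 * (O z.1)ᵀ)).1
      (symCoords (O z.1 * diagonal z.2 * (O z.1)ᵀ)).2) = f (diagonal z.2) := fun z => by
    have hd : (diagonal z.2).IsSymm := isSymm_diagonal _
    rw [symOf_symCoords (hd.conj _), hinv _ hd _ (hmem _)]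
  rw [← hmap] at hint ⊢
  rw [integral_map hT.aemeasurable hint.aestronglyMeasurable]
  have h1 := hint.comp_measurable hT
  simp only [Function.comp_def, hf] at h1 ⊢
  refine ⟨h1.of_comp_snd (NeZero.ne ρ), ?_⟩
  rw [integral_fun_snd (fun E => f (diagonal E)), measureReal_def, hρ,
    ENNReal.toReal_ofReal (frameVolume_pos n).le, Complex.real_smul]

/-- The absolute value of the Vandermonde determinant. -/
lemma prod_abs_sub_eq_abs_det (E : Fin n → ℝ) :
    ∏ a, ∏ b ∈ Ioi a, |E a - E b| = |(vandermonde E).det| := by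
  rw [det_vandermonde]
  simp only [abs_prod, abs_sub_comm]

lemma prod_abs_sub_comp_perm (E : Fin n → ℝ) (σ : Equiv.Perm (Fin n)) :
    ∏ a, ∏ b ∈ Ioi a, |(E ∘ σ) a - (E ∘ σ) b| = ∏ a, ∏ b ∈ Ioi a, |E a - E b| := by
  have h : vandermonde (E ∘ σ) = (vandermonde E).submatrix σ id := rfl
  rw [prod_abs_sub_eq_abs_det, prod_abs_sub_eq_abs_det, h, det_permute, abs_mul]
  rcases Int.units_eq_one_or σ.sign with h | h <;> simp [h]

lemma apply_diagonal_comp_perm {α : Type*} {f : Matrix (Fin n) (Fin n) ℝ → α}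
    (hinv : ∀ H : Matrix (Fin n) (Fin n) ℝ, H.IsSymm →
      ∀ O ∈ Matrix.orthogonalGroup (Fin n) ℝ, f (O * H * Oᵀ) = f H)
    (E : Fin n → ℝ) (σ : Equiv.Perm (Fin n)) : f (diagonal (E ∘ σ)) = f (diagonal E) := by
  have hP : (1 : Matrix (Fin n) (Fin n) ℝ).submatrix σ id ∈ orthogonalGroup (Fin n) ℝ := by
    rw [mem_orthogonalGroup_iff, transpose_submatrix, transpose_one,
      ← submatrix_mul _ _ _ _ _ Function.bijective_id, one_mul, submatrix_one_equiv]
  rw [← hinv _ (isSymm_diagonal E) _ hP, ← submatrix_diagonal_equiv]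
  congr 1
  ext i j
  simp only [submatrix_apply, mul_apply, diagonal_apply, one_apply, transpose_apply, id]
  simp [eq_comm]
  split_ifs with hij <;> simp [hij]

lemma exists_unique_strictAnti_comp_perm {α : Type*} [LinearOrder α] {E : Fin n → α}
    (hE : Function.Injective E) : ∃! σ : Equiv.Perm (Fin n), StrictAnti (E ∘ σ) := by
  refine ⟨Tuple.sort (OrderDual.toDual ∘ E), ?_, fun τ hτ => ?_⟩
  · have h := (Tuple.monotone_sort (OrderDual.toDual ∘ E)).strictMono_of_injective
      (hE.comp (Equiv.injective _))
    exact fun i j hij => h hij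
  · have hσ := Tuple.monotone_sort (OrderDual.toDual ∘ E)
    have h := (hσ.strictMono_of_injective (hE.comp (Equiv.injective _))).range_inj
      (g := OrderDual.toDual ∘ E ∘ τ) (fun i j hij => hτ hij)
    refine Equiv.ext fun i => hE ?_
    refine (congrFun (h.1 ?_) i).symm
    rw [← Function.comp_assoc, EquivLike.range_comp, EquivLike.range_comp]

/-- Integrals of symmetric functions vanishing on non-injective tuples. -/
lemma integral_eq_factorial_mul_integral_strictAnti {F : (Fin n → ℝ) → ℂ}
    (hsymm : ∀ E (σ : Equiv.Perm (Fin n)), F (E ∘ σ) = F E)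
    (hzero : ∀ E, ¬ Function.Injective E → F E = 0)
    (hint : Integrable ({E : Fin n → ℝ | StrictAnti E}.indicator F)) :
    ∫ E, F E = n.factorial * ∫ E, {E : Fin n → ℝ | StrictAnti E}.indicator F E := by
  classical
  have hsum : ∀ E, F E = ∑ σ : Equiv.Perm (Fin n),
      {E : Fin n → ℝ | StrictAnti E}.indicator F (E ∘ σ) := by
    intro E
    by_cases hE : Function.Injective E
    · obtain ⟨τ, hτ, huniq⟩ := exists_unique_strictAnti_comp_perm hE
      rw [sum_eq_single τ (fun σ _ hσ => Set.indicator_of_notMem (fun h => hσ (huniq σ h)) _)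
        (by simp), Set.indicator_of_mem hτ, hsymm]
    · refine (hzero E hE).trans (sum_eq_zero fun σ _ => ?_).symm
      exact Set.indicator_of_notMem (fun h => hE ((Equiv.injective_comp σ E).1 h.injective)) _
  have hperm : ∀ σ : Equiv.Perm (Fin n), MeasurePreserving
      (MeasurableEquiv.piCongrLeft (fun _ : Fin n => ℝ) σ).symm := fun σ =>
    (volume_measurePreserving_piCongrLeft (fun _ : Fin n => ℝ) σ).symm
  have hcomp : ∀ σ : Equiv.Perm (Fin n),
      ∫ E, {E : Fin n → ℝ | StrictAnti E}.indicator F (E ∘ σ) =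
        ∫ E, {E : Fin n → ℝ | StrictAnti E}.indicator F E := fun σ =>
    (hperm σ).integral_comp' _
  have hcompInt : ∀ σ : Equiv.Perm (Fin n),
      Integrable fun E => {E : Fin n → ℝ | StrictAnti E}.indicator F (E ∘ σ) := fun σ =>
    (hperm σ).integrable_comp_of_integrable hint
  rw [integral_congr_ae (Filter.Eventually.of_forall hsum),
    integral_finsetSum _ fun σ _ => hcompInt σ]
  simp [hcomp, Fintype.card_perm]

lemma chamberWeight_lt_top (E : Fin n → ℝ) : chamberWeight E < ⊤ := by
  rw [chamberWeight, Set.indicator_apply]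
  split_ifs <;> simp

lemma toReal_chamberWeight_smul (f : (Fin n → ℝ) → ℂ) (E : Fin n → ℝ) :
    (chamberWeight E).toReal • f E = {E : Fin n → ℝ | StrictAnti E}.indicator
      (fun E => ((∏ a : Fin n, ∏ b ∈ Ioi a, |E a - E b| : ℝ) : ℂ) * f E) E := by
  have h : 0 ≤ ∏ a : Fin n, ∏ b ∈ Ioi a, |E a - E b| :=
    prod_nonneg fun a _ => prod_nonneg fun b _ => abs_nonneg _
  rw [chamberWeight, Set.indicator_apply, Set.indicator_apply]
  split_ifs
  · rw [ENNReal.toReal_ofReal h, Complex.real_smul]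
  · simp

end Weyl


/-- The Weyl eigenvalue integration formula on `Sym(n)` with the explicit constant
`g_n^{(1)} = (1/n!) ∏_{j=1}^n π^{(j-1)/2} Γ(1/2)/Γ(j/2)` (Eqs. (C.5) and (C.9) of the paper
for β = 1). -/
theorem weyl_integration_sym (n : ℕ) (hn : 1 ≤ n)
    (f : Matrix (Fin n) (Fin n) ℝ → ℂ)
    (hinv : ∀ H : Matrix (Fin n) (Fin n) ℝ, H.IsSymm →
      ∀ O ∈ Matrix.orthogonalGroup (Fin n) ℝ, f (O * H * Oᵀ) = f H)
    (hint : Integrable (fun p : (Fin n → ℝ) × (UpperIdx n → ℝ) => f (symOf p.1 p.2))) :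
    ∫ p : (Fin n → ℝ) × (UpperIdx n → ℝ), f (symOf p.1 p.2)
      = (((1 / n.factorial : ℝ) *
            ∏ j ∈ Finset.Icc 1 n,
              Real.pi ^ (((j : ℝ) - 1) / 2) * Real.Gamma (1 / 2) / Real.Gamma ((j : ℝ) / 2)
          : ℝ) : ℂ) *
        ∫ E : Fin n → ℝ,
          ((∏ a : Fin n, ∏ b ∈ Finset.Ioi a, |E a - E b| : ℝ) : ℂ) *
            f (Matrix.diagonal E) := by
  have hfin : ∀ᵐ E : Fin n → ℝ, chamberWeight E < ⊤ :=
    Filter.Eventually.of_forall chamberWeight_lt_top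
  obtain ⟨h1, h2⟩ := integral_symOf_eq_chamber hinv hint
  rw [integrable_withDensity_iff_integrable_smul' measurable_chamberWeight hfin] at h1
  rw [integral_withDensity_eq_integral_toReal_smul measurable_chamberWeight hfin] at h2
  simp only [toReal_chamberWeight_smul fun E => f (diagonal E)] at h1 h2
  rw [h2, integral_eq_factorial_mul_integral_strictAnti (fun E σ => ?_) (fun E hE => ?_) h1,
    ← frameVolume]
  · have : (n.factorial : ℂ) ≠ 0 := by exact_mod_cast n.factorial_ne_zero
    push_cast
    field_simp
  · rw [prod_abs_sub_comp_perm, apply_diagonal_comp_perm hinv]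
  · rw [prod_abs_sub_eq_abs_det, not_not.1 (mt det_vandermonde_ne_zero_iff.1 hE)]
    simp
end
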